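/- arXiv:2501.11461 — 7 statements merged into one kernel-verified Lean document; each statement's English description precedes it below -/
import Mathlib

section
/- Let n be a positive integer and let C be a Johnson code with symmetric distances and degree s ≥ 1 such that |C| = binom(2n−1, s) (a tight code). Then s = 1, or s = n − 1, or s > 0.9999995·n. -/
open Finset

/-- The set of Johnson distances between distinct codewords of `C`. -/
def johnsonDistSet (n : ℕ) (C : Finset (Finset (Fin (2 * n)))) : Finset ℕ :=
  ((C ×ˢ C).filter fun p => p.1 ≠ p.2).image fun p => n - (p.1 ∩ p.2).card

/-- The odd primes that are at most `n`. -/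
def oddPrimesUpTo (n : ℕ) : Finset ℕ := {p ∈ range (n + 1) | p.Prime ∧ p ≠ 2}

theorem mem_oddPrimesUpTo {n p : ℕ} : p ∈ oddPrimesUpTo n ↔ p ≤ n ∧ p.Prime ∧ p ≠ 2 := by
  simp [oddPrimesUpTo]

theorem prod_erase_pow_factorization_dvd_factorial {p b M i₀ : ℕ} (hp : p.Prime) (hp2 : p ≠ 2)
    (hi₀ : i₀ < M)
    (hmax : ∀ i < M, (b + 2 * i).factorization p ≤ (b + 2 * i₀).factorization p) :
    ∏ i ∈ (range M).erase i₀, p ^ (b + 2 * i).factorization p ∣ (M - 1).factorial := by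
  have hsplit : (range M).erase i₀ = range i₀ ∪ Ico (i₀ + 1) M := by
    ext i
    simp only [mem_erase, mem_range, mem_union, mem_Ico]
    omega
  have hdisj : Disjoint (range i₀) (Ico (i₀ + 1) M) := by
    rw [Finset.disjoint_left]
    intro i hi hi'
    simp only [mem_range, mem_Ico] at hi hi'
    omega
  have hcop : ∀ e : ℕ, Nat.Coprime (p ^ e) 2 := fun e =>
    Nat.Coprime.pow_left _ ((Nat.coprime_primes hp Nat.prime_two).2 hp2)
  have hdvd : ∀ i < M, p ^ (b + 2 * i).factorization p ∣ b + 2 * i ∧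
      p ^ (b + 2 * i).factorization p ∣ b + 2 * i₀ := fun i hi =>
    ⟨Nat.ordProj_dvd _ _, (pow_dvd_pow p (hmax i hi)).trans (Nat.ordProj_dvd _ _)⟩
  rw [hsplit, prod_union hdisj]
  have h1 : ∏ i ∈ range i₀, p ^ (b + 2 * i).factorization p ∣ i₀.factorial := by
    rw [← prod_range_add_one_eq_factorial, ← prod_range_reflect]
    refine prod_dvd_prod_of_dvd _ _ fun i hi => ?_
    rw [mem_range] at hi
    obtain ⟨ha, hc⟩ := hdvd (i₀ - 1 - i) (by omega)
    refine (hcop _).dvd_of_dvd_mul_left ?_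
    have := Nat.dvd_sub hc ha
    convert this using 1
    omega
  have h2 : ∏ i ∈ Ico (i₀ + 1) M, p ^ (b + 2 * i).factorization p ∣
      (M - 1 - i₀).factorial := by
    rw [← prod_range_add_one_eq_factorial, prod_Ico_eq_prod_range,
      show M - (i₀ + 1) = M - 1 - i₀ by omega]
    refine prod_dvd_prod_of_dvd _ _ fun i hi => ?_
    rw [mem_range] at hi
    obtain ⟨ha, hc⟩ := hdvd (i₀ + 1 + i) (by omega)
    refine (hcop _).dvd_of_dvd_mul_left ?_
    have := Nat.dvd_sub ha hc
    convert this using 1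
    omega
  refine (mul_dvd_mul h1 h2).trans ?_
  have := Nat.factorial_mul_factorial_dvd_factorial_add i₀ (M - 1 - i₀)
  rwa [show i₀ + (M - 1 - i₀) = M - 1 by omega] at this

theorem two_pow_mul_ordCompl_factorial_le (n : ℕ) :
    2 ^ n * (n.factorial / 2 ^ n.factorial.factorization 2) ≤ (n + 1) * n.factorial := by
  have hsum : 2 ^ (Nat.digits 2 n).sum ≤ n + 1 := by
    induction n using Nat.strong_induction_on with
    | _ n ih =>
      rcases Nat.eq_zero_or_pos n with rfl | hn
      · simp
      · rw [Nat.digits_def' (by norm_num) hn, List.sum_cons, pow_add]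
        have := ih (n / 2) (Nat.div_lt_self hn (by norm_num))
        rcases Nat.mod_two_eq_zero_or_one n with h0 | h0 <;> rw [h0] <;> omega
  have h := sub_one_mul_padicValNat_factorial (p := 2) n
  rw [← Nat.factorization_def _ Nat.prime_two] at h
  have hle := Nat.digit_sum_le 2 n
  have hn : n = (Nat.digits 2 n).sum + n.factorial.factorization 2 := by omega
  have hord := Nat.ordProj_mul_ordCompl_eq_self n.factorial 2
  have hpow : 2 ^ n = 2 ^ (Nat.digits 2 n).sum * 2 ^ n.factorial.factorization 2 := by
    rw [← pow_add, ← hn]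
  rw [hpow, mul_assoc, hord]
  gcongr

/-- Indices at which an odd prime attains its largest exponent in `b, b + 2, …, b + 2 (M - 1)`. -/
theorem exists_max_factorization (b M : ℕ) (hM : 0 < M) :
    ∃ idx : ℕ → ℕ, ∀ p, idx p < M ∧
      ∀ i < M, (b + 2 * i).factorization p ≤ (b + 2 * idx p).factorization p := by
  have : ∀ p, ∃ j, j < M ∧ ∀ i < M, (b + 2 * i).factorization p ≤ (b + 2 * j).factorization p := by
    intro p
    obtain ⟨j, hj, hmax⟩ := exists_max_image (range M) (fun i => (b + 2 * i).factorization p)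
      ⟨0, by simpa using hM⟩
    exact ⟨j, by simpa using hj, fun i hi => hmax i (by simpa using hi)⟩
  choose idx h using this
  exact ⟨idx, h⟩

section SmoothBlock

variable {b M : ℕ}

theorem dvd_ordCompl_factorial_of_factorization_le {Q : ℕ} (hQ : Odd Q)
    (h : Q ∣ (M - 1).factorial) :
    Q ∣ (M - 1).factorial / 2 ^ (M - 1).factorial.factorization 2 := by
  rw [← Nat.ordProj_mul_ordCompl_eq_self (M - 1).factorial 2] at h
  exact (Nat.Coprime.pow_right _ (Nat.coprime_two_right.2 hQ)).dvd_of_dvd_mul_left h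

theorem factorization_eq_zero_of_smooth (hodd : Odd b)
    (hsm : ∀ m < M, ∀ p : ℕ, p.Prime → p ∣ b + 2 * m → p ≤ 2 * M + 1) {p : ℕ}
    (hp : p.Prime) (hpn : p ∉ oddPrimesUpTo (2 * M + 1)) {i : ℕ} (hi : i < M) :
    (b + 2 * i).factorization p = 0 := by
  refine Nat.factorization_eq_zero_of_not_dvd fun hd => hpn ?_
  refine mem_oddPrimesUpTo.2 ⟨hsm i hi p hp hd, hp, ?_⟩
  rintro rfl
  have : Odd (b + 2 * i) := hodd.add_even (even_two_mul i)
  exact (Nat.not_even_iff_odd.2 this) (even_iff_two_dvd.2 hd)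

theorem two_pow_mul_pow_le_factorial (hM : 0 < M) (hodd : Odd b)
    (hsm : ∀ m < M, ∀ p : ℕ, p.Prime → p ∣ b + 2 * m → p ≤ 2 * M + 1) :
    2 ^ (M - 1) * b ^ (M - #(oddPrimesUpTo (2 * M + 1))) ≤ M.factorial := by
  obtain ⟨idx, hidx⟩ := exists_max_factorization b M hM
  have hb : 0 < b := hodd.pos
  set J := (oddPrimesUpTo (2 * M + 1)).image idx with hJ
  have hne : ∀ i ∈ range M \ J, b + 2 * i ≠ 0 := fun i _ => by omega
  have hdvd : ∏ i ∈ range M \ J, (b + 2 * i) ∣ (M - 1).factorial := by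
    rw [← Nat.factorization_le_iff_dvd (prod_ne_zero_iff.2 hne) (Nat.factorial_ne_zero _)]
    intro p
    by_cases hp : p.Prime
    · rw [Nat.factorization_prod hne, Finsupp.finsetSum_apply]
      by_cases hpm : p ∈ oddPrimesUpTo (2 * M + 1)
      · have h := prod_erase_pow_factorization_dvd_factorial hp (mem_oddPrimesUpTo.1 hpm).2.2
          (hidx p).1 (hidx p).2
        rw [prod_pow_eq_pow_sum, hp.pow_dvd_iff_le_factorization (Nat.factorial_ne_zero _)] at h
        refine (sum_le_sum_of_subset ?_).trans h
        intro i hi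
        rw [mem_sdiff] at hi
        refine mem_erase.2 ⟨?_, hi.1⟩
        rintro rfl
        exact hi.2 (mem_image_of_mem _ hpm)
      · refine le_of_eq_of_le (sum_eq_zero fun i hi => ?_) (Nat.zero_le _)
        exact factorization_eq_zero_of_smooth hodd hsm hp hpm (by simpa using (mem_sdiff.1 hi).1)
    · simp [Nat.factorization_eq_zero_of_not_prime _ hp]
  have hoddQ : Odd (∏ i ∈ range M \ J, (b + 2 * i)) :=
    prod_induction _ Odd (fun _ _ => Odd.mul) odd_one fun i _ => hodd.add_even (even_two_mul i)
  have hle := Nat.le_of_dvd (Nat.ordCompl_pos 2 (Nat.factorial_ne_zero _))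
    (dvd_ordCompl_factorial_of_factorization_le hoddQ hdvd)
  have hcard : M - #(oddPrimesUpTo (2 * M + 1)) ≤ #(range M \ J) := by
    have h1 : #J ≤ #(oddPrimesUpTo (2 * M + 1)) := card_image_le
    have h2 := le_card_sdiff J (range M)
    rw [card_range] at h2
    omega
  have hpow : b ^ (M - #(oddPrimesUpTo (2 * M + 1))) ≤ ∏ i ∈ range M \ J, (b + 2 * i) :=
    (Nat.pow_le_pow_right hb hcard).trans (pow_card_le_prod _ _ _ fun i _ => by omega)
  have h2 := two_pow_mul_ordCompl_factorial_le (M - 1)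
  rw [Nat.sub_add_cancel hM, Nat.mul_factorial_pred hM.ne'] at h2
  exact (Nat.mul_le_mul_left _ (hpow.trans hle)).trans h2

theorem two_pow_mul_pow_le_factorial_mul (hM : 0 < M) (hodd : Odd b)
    (hsm : ∀ m < M, ∀ p : ℕ, p.Prime → p ∣ b + 2 * m → p ≤ 2 * M + 1) {R : ℕ}
    (hR : b + 2 * M < (R + 1) ^ 2) :
    2 ^ (M - 1) * b ^ M ≤
      M.factorial * 4 ^ (2 * M + 1) * (b + 2 * M) ^ #(oddPrimesUpTo R) := by
  obtain ⟨idx, hidx⟩ := exists_max_factorization b M hM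
  have hb : 0 < b := hodd.pos
  set S := oddPrimesUpTo (2 * M + 1) with hS
  set O := (M - 1).factorial / 2 ^ (M - 1).factorial.factorization 2 with hO
  have hOpos : 0 < O := Nat.ordCompl_pos 2 (Nat.factorial_ne_zero _)
  set E := ∏ p ∈ S, p ^ (b + 2 * idx p).factorization p with hE
  have hEpos : 0 < E := prod_pos fun p hp => pow_pos (mem_oddPrimesUpTo.1 hp).2.1.pos _
  have hne : ∀ i ∈ range M, b + 2 * i ≠ 0 := fun i _ => by omega
  have hoddP : Odd (∏ i ∈ range M, (b + 2 * i)) :=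
    prod_induction _ Odd (fun _ _ => Odd.mul) odd_one fun i _ => hodd.add_even (even_two_mul i)
  have hdvd' : ∏ i ∈ range M, (b + 2 * i) ∣ (M - 1).factorial * E := by
    rw [← Nat.factorization_le_iff_dvd (prod_ne_zero_iff.2 hne)
      (mul_ne_zero (Nat.factorial_ne_zero _) hEpos.ne')]
    intro p
    by_cases hp : p.Prime
    · rw [Nat.factorization_prod hne, Finsupp.finsetSum_apply]
      by_cases hpm : p ∈ S
      · have h := prod_erase_pow_factorization_dvd_factorial hp (mem_oddPrimesUpTo.1 hpm).2.2
          (hidx p).1 (hidx p).2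
        rw [prod_pow_eq_pow_sum, hp.pow_dvd_iff_le_factorization (Nat.factorial_ne_zero _)] at h
        rw [← add_sum_erase _ _ (mem_range.2 (hidx p).1), add_comm,
          Nat.factorization_mul (Nat.factorial_ne_zero _) hEpos.ne', Finsupp.add_apply]
        refine add_le_add h ?_
        rw [← hp.pow_dvd_iff_le_factorization hEpos.ne']
        exact dvd_prod_of_mem (fun p => p ^ (b + 2 * idx p).factorization p) hpm
      · refine le_of_eq_of_le (sum_eq_zero fun i hi => ?_) (Nat.zero_le _)
        exact factorization_eq_zero_of_smooth hodd hsm hp hpm (by simpa using hi)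
    · simp [Nat.factorization_eq_zero_of_not_prime _ hp]
  have hdvd : ∏ i ∈ range M, (b + 2 * i) ∣ O * E := by
    rw [← Nat.ordProj_mul_ordCompl_eq_self (M - 1).factorial 2, mul_assoc] at hdvd'
    exact (Nat.Coprime.pow_right _ (Nat.coprime_two_right.2 hoddP)).dvd_of_dvd_mul_left hdvd'
  have hle := Nat.le_of_dvd (Nat.mul_pos hOpos hEpos) hdvd
  have hEle : E ≤ 4 ^ (2 * M + 1) * (b + 2 * M) ^ #(oddPrimesUpTo R) := by
    have hterm : ∀ p ∈ S, p ^ (b + 2 * idx p).factorization p ≤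
        p * (if p ∈ oddPrimesUpTo R then b + 2 * M else 1) := by
      intro p hp
      obtain ⟨-, hpp, hp2⟩ := mem_oddPrimesUpTo.1 hp
      have hlt := (hidx p).1
      have hple : p ^ (b + 2 * idx p).factorization p ≤ b + 2 * idx p :=
        Nat.le_of_dvd (by omega) (Nat.ordProj_dvd _ _)
      split_ifs with hpR
      · calc _ ≤ b + 2 * M := by omega
          _ ≤ p * (b + 2 * M) := Nat.le_mul_of_pos_left _ hpp.pos
      · have hRp : R + 1 ≤ p := by
          by_contra hcon
          exact hpR (mem_oddPrimesUpTo.2 ⟨by omega, hpp, hp2⟩)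
        rw [mul_one]
        have h2 : (b + 2 * idx p).factorization p < 2 := by
          by_contra! hcon
          have h3 := Nat.pow_le_pow_right hpp.pos hcon
          have h4 := Nat.pow_le_pow_left hRp 2
          omega
        calc p ^ (b + 2 * idx p).factorization p ≤ p ^ 1 :=
              Nat.pow_le_pow_right hpp.pos (by omega)
          _ = p := pow_one p
    refine (prod_le_prod' hterm).trans ?_
    rw [prod_mul_distrib]
    refine Nat.mul_le_mul ?_ ?_
    · refine le_trans ?_ (primorial_le_four_pow (2 * M + 1))
      rw [primorial]
      refine prod_le_prod_of_subset_of_one_le' ?_ ?_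
      · intro p hp
        have := mem_oddPrimesUpTo.1 hp
        simp only [mem_filter, mem_range]
        exact ⟨by omega, this.2.1⟩
      · intro p hp _
        exact (mem_filter.1 hp).2.one_lt.le
    · rw [← prod_filter, prod_const]
      refine Nat.pow_le_pow_right (by omega) (card_le_card ?_)
      exact fun p hp => (mem_filter.1 hp).2
  have h2 := two_pow_mul_ordCompl_factorial_le (M - 1)
  rw [Nat.sub_add_cancel hM, Nat.mul_factorial_pred hM.ne'] at h2
  have hpow : b ^ M ≤ ∏ i ∈ range M, (b + 2 * i) := by
    have := pow_card_le_prod (range M) (fun i => b + 2 * i) b fun i _ => by omega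
    rwa [card_range] at this
  calc 2 ^ (M - 1) * b ^ M ≤ 2 ^ (M - 1) * (O * E) := Nat.mul_le_mul_left _ (hpow.trans hle)
    _ = (2 ^ (M - 1) * O) * E := by ring
    _ ≤ M.factorial * (4 ^ (2 * M + 1) * (b + 2 * M) ^ #(oddPrimesUpTo R)) :=
        Nat.mul_le_mul h2 hEle
    _ = _ := by ring

end SmoothBlock

section SieveComputation

/-- Checks `m! < 2 ^ (m - 1) * (4 * m + 5) ^ (m - c)` for `fuel` consecutive values of `m`, where
`f = m!` and the bound `c` for the number of odd primes up to `2 * m + 1` are updated at every step,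
counting `2 * m + 3` only if it is coprime to the sieving modulus `w`. -/
def sieveCheck (w : ℕ) : ℕ → ℕ → ℕ → ℕ → Bool
  | 0, _, _, _ => true
  | fuel + 1, m, c, f =>
    Nat.blt f (2 ^ (m - 1) * (4 * m + 5) ^ (m - c)) &&
      sieveCheck w fuel (m + 1)
        (bif Nat.beq (Nat.gcd (2 * m + 3) w) 1 then c + 1 else c) (f * (m + 1))

theorem card_oddPrimesUpTo_succ_le (m : ℕ) :
    #(oddPrimesUpTo (2 * (m + 1) + 1)) ≤
      #(oddPrimesUpTo (2 * m + 1)) + if (2 * m + 3).Prime then 1 else 0 := by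
  split_ifs with h
  · refine (card_le_card ?_).trans (card_insert_le (2 * m + 3) _)
    intro p hp
    obtain ⟨h1, h2, h3⟩ := mem_oddPrimesUpTo.1 hp
    obtain ⟨k, hk⟩ := h2.odd_of_ne_two h3
    rw [mem_insert, mem_oddPrimesUpTo]
    refine (em (p = 2 * m + 3)).imp_right fun _ => ⟨by omega, h2, h3⟩
  · rw [add_zero]
    refine card_le_card fun p hp => ?_
    obtain ⟨h1, h2, h3⟩ := mem_oddPrimesUpTo.1 hp
    obtain ⟨k, hk⟩ := h2.odd_of_ne_two h3
    have : p ≠ 2 * m + 3 := by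
      rintro rfl
      exact h h2
    exact mem_oddPrimesUpTo.2 ⟨by omega, h2, h3⟩

theorem factorial_lt_of_sieveCheck {w : ℕ} (fuel : ℕ) : ∀ {m c : ℕ},
    #(oddPrimesUpTo (2 * m + 1)) ≤ c →
    (∀ q : ℕ, q.Prime → 2 * m + 3 ≤ q → q.Coprime w) →
    sieveCheck w fuel m c m.factorial = true → ∀ M, m ≤ M → M < m + fuel →
    M.factorial < 2 ^ (M - 1) * (4 * M + 5) ^ (M - #(oddPrimesUpTo (2 * M + 1))) := by
  induction fuel with
  | zero => intro m c _ _ _ M h1 h2; omega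
  | succ fuel ih =>
    intro m c hc hw hcheck M h1 h2
    rw [sieveCheck, Bool.and_eq_true, Nat.blt_eq] at hcheck
    rcases h1.eq_or_lt with rfl | h1
    · exact hcheck.1.trans_le (Nat.mul_le_mul_left _ (Nat.pow_le_pow_right (by omega) (by omega)))
    · refine ih (m := m + 1) ?_ (fun q hq hmq => hw q hq (by omega)) ?_ M h1 (by omega)
        (c := bif Nat.beq (Nat.gcd (2 * m + 3) w) 1 then c + 1 else c)
      · refine (card_oddPrimesUpTo_succ_le m).trans ?_
        split_ifs with hp
        · have : Nat.gcd (2 * m + 3) w = 1 := hw _ hp le_rfl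
          simpa [this] using hc
        · cases Nat.beq (Nat.gcd (2 * m + 3) w) 1 <;> simp <;> omega
      · rw [Nat.factorial_succ, mul_comm (m + 1)]
        exact hcheck.2

theorem factorial_lt_of_lt_two_thousand {M : ℕ} (h4 : 4 ≤ M) (hM : M < 2000) :
    M.factorial < 2 ^ (M - 1) * (4 * M + 5) ^ (M - #(oddPrimesUpTo (2 * M + 1))) := by
  have hcop : ∀ r q : ℕ, q.Prime → r < q → q.Coprime r.factorial := fun _ _ hq h =>
    hq.coprime_factorial_of_lt h
  rcases lt_or_ge M 31 with h | h
  · exact factorial_lt_of_sieveCheck (w := Nat.factorial 7) 27 (m := 4) (c := 3) (by decide)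
      (fun q hq h => hcop _ _ hq (by omega)) (by decide +kernel) M h4 (by omega)
  · exact factorial_lt_of_sieveCheck (w := Nat.factorial 61) 1969 (m := 31) (c := 17)
      (by decide +kernel) (fun q hq h => hcop _ _ hq (by omega)) (by decide +kernel) M h (by omega)

end SieveComputation

section PrimeCounting

theorem card_oddPrimesUpTo_add_one_le (n : ℕ) :
    #(oddPrimesUpTo n) ≤ (n + 1).primeCounting' - 1 ∨ n < 2 := by
  refine (lt_or_ge n 2).symm.imp_left fun h => ?_
  rw [← Nat.primesBelow_card_eq_primeCounting', ← card_erase_of_mem (a := 2)]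
  · refine card_le_card fun p hp => ?_
    obtain ⟨h1, h2, h3⟩ := mem_oddPrimesUpTo.1 hp
    exact mem_erase.2 ⟨h3, Nat.mem_primesBelow.2 ⟨by omega, h2⟩⟩
  · exact Nat.mem_primesBelow.2 ⟨by omega, Nat.prime_two⟩

theorem card_oddPrimesUpTo_le_div_three (n : ℕ) : #(oddPrimesUpTo n) ≤ n / 3 + 2 := by
  rcases lt_or_ge n 7 with h | h
  · interval_cases n <;> decide
  · have h1 := (card_oddPrimesUpTo_add_one_le n).resolve_right (by omega)
    have h2 := Nat.primeCounting'_add_le (a := 6) (k := 7) (by norm_num) (by norm_num) (n - 6)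
    rw [show 7 + (n - 6) = n + 1 by omega, show Nat.totient 6 = 2 by decide,
      show Nat.primeCounting' 7 = 3 by decide] at h2
    omega

theorem two_mul_card_oddPrimesUpTo_le {M : ℕ} (hM : 2000 ≤ M) :
    2 * #(oddPrimesUpTo (2 * M + 1)) ≤ M := by
  have h1 := (card_oddPrimesUpTo_add_one_le (2 * M + 1)).resolve_right (by omega)
  have h2 := Nat.primeCounting'_add_le (a := 210) (k := 211) (by norm_num) (by norm_num)
    (2 * M - 209)
  rw [show 211 + (2 * M - 209) = 2 * M + 1 + 1 by omega,
    show Nat.totient 210 = 48 by decide +kernel,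
    show Nat.primeCounting' 211 = 46 by decide +kernel] at h2
  omega

end PrimeCounting

section LogEstimates

open Real

theorem log_factorial_le {M : ℕ} (hM : 0 < M) :
    log M.factorial ≤ (M + 1) * log M - M + 1 := by
  induction M, hM using Nat.le_induction with
  | base => simp
  | succ M hM ih =>
    have hM0 : (0 : ℝ) < M := by exact_mod_cast hM
    rw [Nat.factorial_succ, Nat.cast_mul, log_mul (by positivity) (by positivity)]
    have h := one_sub_inv_le_log_of_pos (x := ((M + 1 : ℕ) : ℝ) / M) (by positivity)
    rw [log_div (by positivity) hM0.ne', inv_div] at h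
    have h' : 1 ≤ ((M : ℝ) + 1) * (log ((M + 1 : ℕ) : ℝ) - log M) := by
      calc (1 : ℝ) = (M + 1) * (1 - M / ((M + 1 : ℕ) : ℝ)) := by push_cast; field_simp; ring
        _ ≤ _ := by gcongr
    push_cast at h' ⊢
    linarith

theorem log_le_of_two_pow (k : ℕ) {x : ℝ} (hx : 0 < x) :
    log x ≤ k * log 2 - 1 + x / 2 ^ k := by
  have h := log_le_sub_one_of_pos (x := x / 2 ^ k) (by positivity)
  rw [log_div hx.ne' (by positivity), log_pow] at h
  linarith

/-- No odd `b > M ^ 2 / 25` satisfies the counting inequality for smooth blocks. -/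
theorem factorial_lt_of_sq_lt {b M : ℕ} (hM : 2000 ≤ M) (hb : M ^ 2 < 25 * b) :
    M.factorial < 2 ^ (M - 1) * b ^ (M - #(oddPrimesUpTo (2 * M + 1))) := by
  by_contra! hle
  have hcnt := two_mul_card_oddPrimesUpTo_le hM
  set c := #(oddPrimesUpTo (2 * M + 1))
  have hb0 : 0 < b := by
    rcases Nat.eq_zero_or_pos b with rfl | h
    · omega
    · exact h
  have hM' : (2000 : ℝ) ≤ M := by exact_mod_cast hM
  have hlog := log_le_log (by positivity) (Nat.cast_le (α := ℝ).2 hle)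
  rw [Nat.cast_mul, Nat.cast_pow, Nat.cast_pow, log_mul (by positivity) (by positivity), log_pow,
    log_pow, Nat.cast_sub (by omega), Nat.cast_sub (by omega)] at hlog
  push_cast at hlog
  have hfac := log_factorial_le (M := M) (by omega)
  have hbM : 2 * log M ≤ 2 * log 5 + log b := by
    have := log_le_log (by positivity) (Nat.cast_le (α := ℝ).2 hb.le)
    push_cast at this
    rw [log_mul (by norm_num) (by positivity), show (25 : ℝ) = 5 ^ 2 by norm_num, log_pow,
      log_pow] at this
    exact_mod_cast this
  have h5 : 3 * log 5 ≤ 7 * log 2 := by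
    have := log_le_log (by norm_num) (show (5 : ℝ) ^ 3 ≤ 2 ^ 7 by norm_num)
    rw [log_pow, log_pow] at this
    exact_mod_cast this
  have hb1 : 0 ≤ log b := log_natCast_nonneg b
  have hcnt' : 2 * (c : ℝ) ≤ M := by exact_mod_cast hcnt
  have hmain : (M : ℝ) / 2 * (2 * log M - 2 * log 5) ≤ (M - c) * log b := by
    calc (M : ℝ) / 2 * (2 * log M - 2 * log 5) ≤ M / 2 * log b := by gcongr; linarith
      _ ≤ (M - c) * log b := by gcongr; linarith
  have hL := log_le_of_two_pow 11 (x := M) (by positivity)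
  have hl1 := log_two_gt_d9
  have hl2 := log_two_lt_d9
  norm_num at hL
  nlinarith

/-- For `4 M ≤ b ≤ M ^ 2 / 25` the primorial bound for smooth blocks fails. -/
theorem factorial_mul_lt_of_le_sq {b M R : ℕ} (hM : 2000 ≤ M) (h4 : 4 * M ≤ b)
    (hb : 25 * b ≤ M ^ 2) (hR : R ^ 2 ≤ b + 2 * M) :
    M.factorial * 4 ^ (2 * M + 1) * (b + 2 * M) ^ #(oddPrimesUpTo R) < 2 ^ (M - 1) * b ^ M := by
  by_contra! hle
  have hM' : (2000 : ℝ) ≤ M := by exact_mod_cast hM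
  have h4' : 4 * (M : ℝ) ≤ b := by exact_mod_cast h4
  have hb' : 25 * (b : ℝ) ≤ M ^ 2 := by exact_mod_cast hb
  have hb0 : (0 : ℝ) < b := by linarith
  have hM0 : (0 : ℝ) < M := by linarith
  have hbpos : 0 < b := by omega
  have hcnt : (#(oddPrimesUpTo R) : ℝ) ≤ √(b + 2 * M) / 3 + 2 := by
    have h1 := card_oddPrimesUpTo_le_div_three R
    have h2 : (#(oddPrimesUpTo R) : ℝ) ≤ R / 3 + 2 := by
      calc (#(oddPrimesUpTo R) : ℝ) ≤ ((R / 3 + 2 : ℕ) : ℝ) := by exact_mod_cast h1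
        _ ≤ _ := by push_cast; gcongr; exact Nat.cast_div_le
    have h3 : (R : ℝ) ≤ √(b + 2 * M) := le_sqrt_of_sq_le (by exact_mod_cast hR)
    linarith
  set c := #(oddPrimesUpTo R)
  have hlog := log_le_log (by positivity) (Nat.cast_le (α := ℝ).2 hle)
  push_cast at hlog
  rw [log_mul (by positivity) (by positivity), log_mul (by positivity) (by positivity),
    log_mul (by positivity) (by positivity), log_pow, log_pow, log_pow, log_pow,
    Nat.cast_sub (by omega), show (4 : ℝ) = 2 ^ 2 by norm_num, log_pow] at hlog
  push_cast at hlog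
  have hfac := log_factorial_le (M := M) (by omega)
  have hL := log_le_of_two_pow 11 hM0
  have hl1 := log_two_gt_d9
  have hl2 := log_two_lt_d9
  norm_num at hL
  have hX1 : (1 : ℝ) ≤ b + 2 * M := by linarith
  have hlogX : 0 ≤ log (b + 2 * M) := log_nonneg hX1
  have hcntX : c * log (b + 2 * M) ≤ (√(b + 2 * M) / 3 + 2) * log (b + 2 * M) := by gcongr
  have hbase : M * (log b - log M + 1 - 3 * log 2) ≤
      log M + 1 + 3 * log 2 + (√(b + 2 * M) / 3 + 2) * log (b + 2 * M) := by nlinarith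
  rcases le_total (b : ℝ) (8 * M) with h8 | h8
  · have hlb : 2 * log 2 ≤ log b - log M := by
      have := log_le_log (by positivity) h4'
      rw [log_mul (by norm_num) hM0.ne', show (4 : ℝ) = 2 ^ 2 by norm_num, log_pow] at this
      push_cast at this
      linarith
    set r := √(10 * (M : ℝ)) with hr
    have hrsq : r ^ 2 = 10 * M := sq_sqrt (by positivity)
    have hr141 : 141 ≤ r := le_sqrt_of_sq_le (by linarith)
    have hXr : √(b + 2 * M) ≤ r := sqrt_le_sqrt (by linarith)
    have hlogr : log (b + 2 * M) ≤ 2 * log r := by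
      rw [← Nat.cast_two, ← log_pow, hrsq]
      refine log_le_log ?_ ?_ <;> push_cast <;> linarith
    have hlr := log_le_of_two_pow 7 (x := r) (by linarith)
    norm_num at hlr
    have hprod : (√(b + 2 * M) / 3 + 2) * log (b + 2 * M) ≤
        (r / 3 + 2) * (2 * (7 * 0.6931471808 - 1 + r / 128)) := by
      gcongr
      linarith
    nlinarith
  · set q := √(b : ℝ) / M with hq
    have hsb : √(b : ℝ) = q * M := by rw [hq]; field_simp
    have hq0 : 0 < q := by positivity
    have hq5 : q ≤ 1 / 5 := by
      rw [hq, div_le_iff₀ hM0]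
      exact sqrt_le_iff.2 ⟨by positivity, by nlinarith⟩
    have hlogq : log q = log b / 2 - log M := by
      rw [hq, log_div (by positivity) hM0.ne', log_sqrt hb0.le]
    have hXq : √(b + 2 * M) ≤ 1.12 * (q * M) := by
      rw [← hsb]
      refine sqrt_le_iff.2 ⟨by positivity, ?_⟩
      rw [mul_pow, sq_sqrt hb0.le]
      linarith
    have hlogX' : log (b + 2 * M) ≤ log b + 1 / 4 := by
      have h1 : log (b + 2 * M) ≤ log (b * (5 / 4)) := log_le_log (by linarith) (by linarith)
      rw [log_mul hb0.ne' (by norm_num)] at h1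
      have := log_le_sub_one_of_pos (x := (5 / 4 : ℝ)) (by norm_num)
      linarith
    set y := log b - log M with hy
    have hylow : 3 * log 2 ≤ y := by
      have := log_le_log (by positivity) h8
      rw [log_mul (by norm_num) hM0.ne', show (8 : ℝ) = 2 ^ 3 by norm_num, log_pow] at this
      push_cast at this
      linarith
    have hqlog : q * -log q ≤ 0.328 := by
      have h := log_le_sub_one_of_pos (x := 1 / (2 ^ 2 * q)) (by positivity)
      rw [log_div one_ne_zero (by positivity), log_mul (by norm_num) hq0.ne', log_pow,
        log_one] at h
      have h' : -log q ≤ 2 * 0.6931471808 - 1 + 1 / (2 ^ 2 * q) := by push_cast at h; linarith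
      calc q * -log q ≤ q * (2 * 0.6931471808 - 1 + 1 / (2 ^ 2 * q)) := by gcongr
        _ = q * (2 * 0.6931471808 - 1) + 1 / 4 := by field_simp; ring
        _ ≤ 0.328 := by linarith
    have hyL : y ≤ log M := by
      have h1 : log b ≤ log ((M : ℝ) ^ 2) := log_le_log hb0 (by linarith)
      rw [log_pow] at h1
      push_cast at h1
      linarith
    have hprod : (√(b + 2 * M) / 3 + 2) * log (b + 2 * M) ≤
        M * (1.12 / 3) * (0.4 * y + 0.656 + 0.05) + 2 * (2 * log M + 1 / 4) := by
      calc (√(b + 2 * M) / 3 + 2) * log (b + 2 * M)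
          ≤ (1.12 * (q * M) / 3 + 2) * (log b + 1 / 4) := by gcongr
        _ = M * (1.12 / 3) * (2 * (q * y) + 2 * (q * -log q) + q / 4) +
            2 * (log M + y + 1 / 4) := by rw [hlogq, hy]; ring
        _ ≤ _ := by
          have hqy : q * y ≤ 1 / 5 * y := by
            gcongr
            linarith
          have hq' : 2 * (q * y) + 2 * (q * -log q) + q / 4 ≤ 0.4 * y + 0.656 + 0.05 := by linarith
          have := mul_le_mul_of_nonneg_left hq' (by positivity : 0 ≤ (M : ℝ) * (1.12 / 3))
          linarith
    nlinarith

end LogEstimates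

/-- A Sylvester-type theorem: a block of `M` consecutive odd numbers, the least of which is at
least `4 * M + 5`, contains a multiple of a prime exceeding `2 * M + 1`. -/
theorem exists_large_prime_dvd {b M : ℕ} (hM : 4 ≤ M) (hb : 4 * M + 5 ≤ b) (hodd : Odd b) :
    ∃ m < M, ∃ p : ℕ, p.Prime ∧ p ∣ b + 2 * m ∧ 2 * M + 1 < p := by
  by_contra! hsm
  have h2 := two_pow_mul_pow_le_factorial (by omega) hodd hsm
  rcases lt_or_ge M 2000 with h | h
  · have h1 := factorial_lt_of_lt_two_thousand hM h
    have h3 := Nat.mul_le_mul_left (2 ^ (M - 1))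
      (Nat.pow_le_pow_left hb (M - #(oddPrimesUpTo (2 * M + 1))))
    omega
  · rcases lt_or_ge (M ^ 2) (25 * b) with hb2 | hb2
    · exact (factorial_lt_of_sq_lt h hb2).not_ge h2
    · exact (factorial_mul_lt_of_le_sq h (by omega) hb2 (Nat.sqrt_le' (b + 2 * M))).not_ge
        (two_pow_mul_pow_le_factorial_mul (by omega) hodd hsm (Nat.lt_succ_sqrt' (b + 2 * M)))

section Divisibility

theorem Nat.Prime.exists_dvd_of_dvd_descFactorial {p : ℕ} (hp : p.Prime) {n k : ℕ}
    (h : p ∣ n.descFactorial k) : ∃ i < k, p ∣ n - i := by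
  rw [Nat.descFactorial_eq_prod_range, hp.prime.dvd_finsetProd_iff] at h
  simpa using h

theorem prime_le_of_dvd_descFactorial_dvd {s a m p : ℕ} (ha : 2 ≤ a) (hm : 2 * (m + 1) ≤ s)
    (h : (2 * a + 2 * (m + 1) - 1).descFactorial (2 * (m + 1)) ∣
      s.choose (2 * (m + 1)) * (a - 1 + 2 * (m + 1)).descFactorial (2 * (m + 1)) *
        (a - 2 + 2 * (m + 1)).descFactorial (2 * (m + 1)))
    (hp : p.Prime) (hpd : p ∣ 2 * a + 1 + 2 * m) : p ≤ 2 * (s / 2) + 1 := by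
  have hpd' : p ∣ (2 * a + 2 * (m + 1) - 1).descFactorial (2 * (m + 1)) := by
    rw [Nat.descFactorial_eq_prod_range]
    refine hpd.trans (dvd_trans (dvd_of_eq ?_) (dvd_prod_of_mem _ (mem_range.2 (by omega : 0 < _))))
    omega
  have hodd : ∀ d : ℤ, (p : ℤ) ∣ 2 * d + 1 → |2 * d + 1| ≤ 2 * m + 3 → p ≤ 2 * (s / 2) + 1 := by
    intro d hd hle
    have := Int.le_of_dvd (abs_pos.2 (by omega)) ((dvd_abs _ _).2 hd)
    omega
  rcases hp.dvd_mul.1 (hpd'.trans h) with h1 | h1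
  · rcases hp.dvd_mul.1 h1 with h2 | h2
    · have h3 : p ∣ s.factorial := by
        rw [← Nat.choose_mul_factorial_mul_factorial hm, mul_assoc]
        exact h2.mul_right _
      have := hp.dvd_factorial.1 h3
      omega
    · obtain ⟨i, hi, hd⟩ := hp.exists_dvd_of_dvd_descFactorial h2
      refine hodd (i - m - 1) ?_ (by rw [abs_le]; constructor <;> omega)
      rw [show (2 * ((i : ℤ) - m - 1) + 1) =
        (2 * a + 1 + 2 * m : ℕ) - 2 * (a - 1 + 2 * (m + 1) - i : ℕ) by omega]
      exact dvd_sub (Int.natCast_dvd_natCast.2 hpd) ((Int.natCast_dvd_natCast.2 hd).mul_left 2)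
  · obtain ⟨i, hi, hd⟩ := hp.exists_dvd_of_dvd_descFactorial h1
    refine hodd (i - m) ?_ (by rw [abs_le]; constructor <;> omega)
    rw [show (2 * ((i : ℤ) - m) + 1) =
      (2 * a + 1 + 2 * m : ℕ) - 2 * (a - 2 + 2 * (m + 1) - i : ℕ) by omega]
    exact dvd_sub (Int.natCast_dvd_natCast.2 hpd) ((Int.natCast_dvd_natCast.2 hd).mul_left 2)

theorem two_mul_add_one_dvd_of_descFactorial_dvd {c a : ℕ} (ha : 2 ≤ a)
    (h : (2 * a + 2 - 1).descFactorial 2 ∣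
      c * (a - 1 + 2).descFactorial 2 * (a - 2 + 2).descFactorial 2) : 2 * a + 1 ∣ 3 * c := by
  obtain ⟨d, rfl⟩ := Nat.exists_eq_add_of_le' ha
  have h1 : 2 * (d + 2) + 1 ∣ c * (d + 3) * (d + 1) * (d + 2) ^ 2 := by
    refine (Dvd.intro (2 * (d + 2)) ?_).trans (h.trans (dvd_of_eq ?_))
    · simp only [Nat.descFactorial]
      rw [show 2 * (d + 2) + 2 - 1 = 2 * d + 5 by omega]
      simp
      ring_nf
    · simp only [Nat.descFactorial]
      rw [show d + 2 - 1 + 2 = d + 3 by omega, show d + 2 - 2 + 2 = d + 2 by omega]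
      simp
      ring
  have hcop : Nat.Coprime (2 * (d + 2) + 1) ((d + 2) ^ 2) := by
    refine Nat.Coprime.pow_right _ ?_
    simp
  have h2 := (hcop.dvd_of_dvd_mul_right h1).mul_left 4
  have h3 : 4 * (c * (d + 3) * (d + 1)) + 3 * c = (2 * (d + 2) + 1) * (c * (2 * (d + 2) - 1)) := by
    rw [show 2 * (d + 2) - 1 = 2 * d + 3 by omega]
    ring
  exact (Nat.dvd_add_right h2).1 (h3 ▸ Dvd.intro _ rfl)

/-- The coefficients of the Wilson polynomial of degree `s` cannot all be integers. -/
theorem not_forall_descFactorial_dvd {s a : ℕ} (hs : 2 ≤ s) (ha : s + 2 ≤ a) :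
    ¬ ∀ t ≤ s, (2 * a + t - 1).descFactorial t ∣
      s.choose t * (a - 1 + t).descFactorial t * (a - 2 + t).descFactorial t := by
  intro h
  rcases lt_or_ge s 8 with hs8 | hs8
  · have h3 := Nat.le_of_dvd (by have := Nat.choose_pos hs; omega)
      (two_mul_add_one_dvd_of_descFactorial_dvd (by omega) (h 2 hs))
    have ha32 : a < 32 := by
      have := Nat.choose_le_choose 2 (show s ≤ 7 by omega)
      have h7 : Nat.choose 7 2 = 21 := by decide
      omega
    have key : ∀ s < 8, ∀ a < 32, 2 ≤ s → s + 2 ≤ a → ¬ ∀ t < s + 1,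
        (2 * a + t - 1).descFactorial t ∣
          s.choose t * (a - 1 + t).descFactorial t * (a - 2 + t).descFactorial t := by
      decide +kernel
    exact key s hs8 a ha32 hs ha fun t ht => h t (by omega)
  · obtain ⟨m, hm, p, hp, hpd, hlt⟩ := exists_large_prime_dvd (b := 2 * a + 1) (M := s / 2)
      (by omega) (by omega) (odd_two_mul_add_one a)
    exact hlt.not_ge
      (prime_le_of_dvd_descFactorial_dvd (by omega) (by omega) (h _ (by omega)) hp hpd)

end Divisibility

section WilsonPolynomial

open Polynomial in
theorem sum_neg_one_pow_mul_choose_mul_eval_eq_zero {s : ℕ} {P : ℚ[X]} (hP : P.natDegree < s) :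
    ∑ i ∈ range (s + 1), (-1 : ℚ) ^ (s - i) * s.choose i * P.eval (i : ℚ) = 0 := by
  have h := congrFun (Polynomial.fwdDiff_iter_eq_zero_of_degree_lt hP) (0 : ℚ)
  rw [fwdDiff_iter_eq_sum_shift] at h
  simpa using h

/-- The coefficient of the falling factorial `(X)_i` in the Wilson polynomial of degree `s` for
`2 * s`-designs with block size `k` on `2 * k + 1` points. -/
def wilsonCoeff (k s i : ℕ) : ℚ :=
  (-1) ^ (s - i) * s.choose i * ((k - i).descFactorial (s - i) * (k - i - 1).descFactorial (s - i)) /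
    (2 * k + 1 - s - i).descFactorial (s - i)

theorem cast_descFactorial_eq_div {n r : ℕ} (h : r ≤ n) :
    (n.descFactorial r : ℚ) = n.factorial / (n - r).factorial := by
  rw [eq_div_iff (by positivity), mul_comm]
  exact_mod_cast Nat.factorial_mul_descFactorial h

theorem wilsonCoeff_self {k s : ℕ} : wilsonCoeff k s s = 1 := by
  simp [wilsonCoeff]

open Polynomial in
theorem sum_wilsonCoeff_mul_eq_zero {k s j : ℕ} (hk : 2 * s < k) (hj : 0 < j) (hjs : j ≤ s) :
    ∑ i ∈ range (s + 1), wilsonCoeff k s i *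
      (k.descFactorial i * (k - i).descFactorial j * (2 * k + 1 - i - j).choose (k - i)) = 0 := by
  set P : ℚ[X] := (∏ l ∈ range (j - 1), (C ((k - 1 - l : ℕ) : ℚ) - X)) *
    ∏ l ∈ range (s - j), (C ((2 * k + 1 - j - l : ℕ) : ℚ) - X) with hP
  have hdeg : P.natDegree < s := by
    refine (natDegree_eq_of_degree_eq_some (n := j - 1 + (s - j)) ?_).trans_lt (by omega)
    have hlin : ∀ c : ℚ, (C c - X : ℚ[X]).degree = 1 := fun c => by
      rw [← neg_sub, degree_neg, degree_X_sub_C]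
    rw [hP, degree_mul, degree_prod, degree_prod]
    simp only [hlin, sum_const, card_range, nsmul_eq_mul, mul_one]
    norm_cast
  have heval : ∀ i ≤ s, P.eval (i : ℚ) =
      (k - i - 1).descFactorial (j - 1) * (2 * k + 1 - i - j).descFactorial (s - j) := by
    intro i hi
    rw [hP, eval_mul, eval_prod, eval_prod, Nat.descFactorial_eq_prod_range,
      Nat.descFactorial_eq_prod_range, Nat.cast_prod, Nat.cast_prod]
    congr 1 <;> refine prod_congr rfl fun l hl => ?_ <;> rw [mem_range] at hl <;>
      rw [eval_sub, eval_C, eval_X, sub_eq_iff_eq_add] <;> norm_cast <;> omega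
  have hterm : ∀ i ∈ range (s + 1), wilsonCoeff k s i *
      (k.descFactorial i * (k - i).descFactorial j * (2 * k + 1 - i - j).choose (k - i)) =
      (k.factorial / (k - s).factorial * (2 * k + 1 - 2 * s).factorial /
        ((k - 1 - s).factorial * (k + 1 - j).factorial)) *
      ((-1 : ℚ) ^ (s - i) * s.choose i * P.eval (i : ℚ)) := by
    intro i hi
    rw [mem_range] at hi
    rw [heval i (by omega), wilsonCoeff, Nat.cast_choose ℚ (show k - i ≤ 2 * k + 1 - i - j by omega),
      cast_descFactorial_eq_div (show s - i ≤ k - i by omega),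
      cast_descFactorial_eq_div (show s - i ≤ k - i - 1 by omega),
      cast_descFactorial_eq_div (show s - i ≤ 2 * k + 1 - s - i by omega),
      cast_descFactorial_eq_div (show i ≤ k by omega),
      cast_descFactorial_eq_div (show j ≤ k - i by omega),
      cast_descFactorial_eq_div (show j - 1 ≤ k - i - 1 by omega),
      cast_descFactorial_eq_div (show s - j ≤ 2 * k + 1 - i - j by omega),
      show k - i - (s - i) = k - s by omega, show k - i - 1 - (s - i) = k - 1 - s by omega,
      show 2 * k + 1 - s - i - (s - i) = 2 * k + 1 - 2 * s by omega,
      show k - i - 1 - (j - 1) = k - i - j by omega,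
      show 2 * k + 1 - i - j - (s - j) = 2 * k + 1 - s - i by omega,
      show 2 * k + 1 - i - j - (k - i) = k + 1 - j by omega]
    field_simp
  rw [sum_congr rfl hterm, ← mul_sum, sum_neg_one_pow_mul_choose_mul_eval_eq_zero hdeg, mul_zero]

end WilsonPolynomial

section NewtonExpansion

theorem sub_mul_descFactorial (x i : ℕ) :
    ((x : ℤ) - i) * x.descFactorial i = x.descFactorial (i + 1) := by
  rcases le_or_gt i x with h | h
  · rw [Nat.descFactorial_succ]
    push_cast [h]
    ring
  · simp [Nat.descFactorial_of_lt h]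

/-- A monic product of integer linear factors is an integral combination of falling factorials. -/
theorem exists_prod_sub_eq_sum_descFactorial (X : Finset ℕ) :
    ∃ f : ℕ → ℤ, f #X = 1 ∧ (∀ i, #X < i → f i = 0) ∧
      ∀ x : ℕ, ∏ a ∈ X, ((x : ℤ) - a) = ∑ i ∈ range (#X + 1), f i * x.descFactorial i := by
  induction X using Finset.induction_on with
  | empty => exact ⟨fun i => if i = 0 then 1 else 0, by simp, by simp; omega, by simp⟩
  | insert a X ha ih =>
    obtain ⟨f, hf1, hf0, hf⟩ := ih
    refine ⟨fun i => (if i = 0 then 0 else f (i - 1)) + (i - a) * f i, ?_, ?_, fun x => ?_⟩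
    · rw [card_insert_of_notMem ha]
      simp [hf1, hf0]
    · intro i hi
      rw [card_insert_of_notMem ha] at hi
      simp [show i ≠ 0 by omega, hf0 i (by omega), hf0 (i - 1) (by omega)]
    · rw [prod_insert ha, card_insert_of_notMem ha, hf]
      have h1 : ∑ i ∈ range (#X + 1), f i * x.descFactorial (i + 1) =
          ∑ i ∈ range (#X + 1 + 1), (if i = 0 then 0 else f (i - 1)) * x.descFactorial i := by
        rw [sum_range_succ' _ (#X + 1)]
        simp
      have h2 : ∑ i ∈ range (#X + 1), (i - a) * f i * x.descFactorial i =
          ∑ i ∈ range (#X + 1 + 1), ((i : ℤ) - a) * f i * x.descFactorial i := by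
        rw [sum_range_succ _ (#X + 1), hf0 (#X + 1) (by omega)]
        simp
      simp only [add_mul]
      rw [sum_add_distrib, ← h1, ← h2, ← sum_add_distrib, mul_sum]
      refine sum_congr rfl fun i _ => ?_
      rw [← sub_mul_descFactorial]
      ring

theorem eq_zero_of_sum_mul_descFactorial_eq_zero {X : Finset ℕ} {c : ℕ → ℚ}
    (h : ∀ a ∈ X, ∑ i ∈ range #X, c i * a.descFactorial i = 0) : ∀ i < #X, c i = 0 := by
  have hP : ∑ i ∈ range #X, Polynomial.C (c i) * descPochhammer ℚ i = 0 := by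
    refine Polynomial.eq_zero_of_degree_lt_of_eval_finset_eq_zero
      (X.image (Nat.cast : ℕ → ℚ)) ?_ ?_
    · rw [card_image_of_injective _ Nat.cast_injective]
      rw [← Polynomial.mem_degreeLT]
      refine Submodule.sum_mem _ fun i hi => ?_
      rw [Polynomial.mem_degreeLT]
      refine Polynomial.degree_le_natDegree.trans_lt (lt_of_le_of_lt (b := (i : WithBot ℕ)) ?_ ?_)
      · exact_mod_cast (Polynomial.natDegree_C_mul_le _ _).trans (descPochhammer_natDegree ℚ i).le
      · exact_mod_cast mem_range.1 hi
    · intro x hx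
      obtain ⟨a, ha, rfl⟩ := mem_image.1 hx
      rw [Polynomial.eval_finsetSum]
      simpa [descPochhammer_eval_eq_descFactorial] using h a ha
  intro i
  induction i using Nat.strong_induction_on with
  | _ i ih =>
    intro hi
    have h1 := congrArg (Polynomial.eval (i : ℚ)) hP
    rw [Polynomial.eval_finsetSum, sum_eq_single i] at h1
    · simpa [descPochhammer_eval_eq_descFactorial, Nat.factorial_ne_zero] using h1
    · intro m hm hmi
      rcases hmi.lt_or_gt with h2 | h2
      · simp [ih m h2 (h2.trans hi)]
      · simp [descPochhammer_eval_eq_descFactorial, Nat.descFactorial_of_lt h2]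
    · simp [hi]

end NewtonExpansion

section WilsonIntegrality

variable {k s : ℕ} {X : Finset ℕ}

theorem sum_wilsonCoeff_mul_descFactorial_eq_zero {β : Type*} (hk : 2 * s < k) (hX : #X = s)
    (hXk : ∀ a ∈ X, a < k) {Y : Finset β} {d : β → ℕ}
    (hd : ∀ y ∈ Y, d y = k ∨ d y ∈ X) {c : ℚ}
    (hmom : ∀ i j, i + j ≤ 2 * s →
      ∑ y ∈ Y, ((d y).descFactorial i * (k - d y).descFactorial j : ℚ) =
        c * (k.descFactorial i * (k - i).descFactorial j * (2 * k + 1 - i - j).choose (k - i)))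
    {a : ℕ} (ha : a ∈ X) (hay : ∃ y ∈ Y, d y = a) :
    ∑ i ∈ range (s + 1), wilsonCoeff k s i * a.descFactorial i = 0 := by
  set F : ℕ → ℚ := fun x => ∑ i ∈ range (s + 1), wilsonCoeff k s i * x.descFactorial i with hF
  have horth : ∀ j, 0 < j → j ≤ s → ∑ y ∈ Y, F (d y) * (k - d y).descFactorial j = 0 := by
    intro j hj hjs
    calc ∑ y ∈ Y, F (d y) * (k - d y).descFactorial j
        = ∑ i ∈ range (s + 1), wilsonCoeff k s i *
            ∑ y ∈ Y, ((d y).descFactorial i * (k - d y).descFactorial j : ℚ) := by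
          simp only [hF, sum_mul, mul_sum]
          rw [sum_comm]
          exact sum_congr rfl fun _ _ => sum_congr rfl fun _ _ => by ring
      _ = c * ∑ i ∈ range (s + 1), wilsonCoeff k s i *
            (k.descFactorial i * (k - i).descFactorial j * (2 * k + 1 - i - j).choose (k - i)) := by
          rw [mul_sum]
          refine sum_congr rfl fun i hi => ?_
          rw [hmom i j (by have := mem_range.1 hi; omega)]
          ring
      _ = 0 := by rw [sum_wilsonCoeff_mul_eq_zero hk hj hjs, mul_zero]
  obtain ⟨g, -, -, hg⟩ := exists_prod_sub_eq_sum_descFactorial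
    ((X.erase a).image fun b => k - 1 - b)
  set H : ℕ → ℚ := fun x => ∏ b ∈ X.erase a, ((b : ℚ) - x) with hH
  have hinj : Set.InjOn (fun b => k - 1 - b) (X.erase a : Set ℕ) := by
    intro b hb b' hb' h
    have h1 := hXk b (mem_of_mem_erase hb)
    have h2 := hXk b' (mem_of_mem_erase hb')
    simp only at h
    omega
  have hcard : #((X.erase a).image fun b => k - 1 - b) + 1 = s := by
    rw [card_image_of_injOn hinj, card_erase_of_mem ha, hX]
    have := card_pos.2 ⟨a, ha⟩
    omega
  have hexp : ∀ x ≤ k, (k - x : ℕ) * H x =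
      ∑ j ∈ range s, (g j : ℚ) * (k - x).descFactorial (j + 1) := by
    intro x hx
    rcases hx.eq_or_lt with rfl | hx
    · simp
    · have h1 := congrArg (Int.cast : ℤ → ℚ) (hg (k - 1 - x))
      rw [hcard, prod_image hinj] at h1
      push_cast at h1
      have h2 : H x = ∑ j ∈ range s, (g j : ℚ) * (k - 1 - x).descFactorial j := by
        rw [← h1]
        refine prod_congr rfl fun b hb => ?_
        have := hXk b (mem_of_mem_erase hb)
        rw [Nat.cast_sub (show x ≤ k - 1 by omega), Nat.cast_sub (show b ≤ k - 1 by omega)]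
        ring
      rw [h2, mul_sum]
      refine sum_congr rfl fun j _ => ?_
      rw [show k - x = k - 1 - x + 1 by omega, Nat.succ_descFactorial_succ]
      push_cast
      ring
  have hdk : ∀ y ∈ Y, d y ≤ k := fun y hy =>
    (hd y hy).elim (fun h => h.le) fun h => (hXk _ h).le
  have hzero : ∑ y ∈ Y, F (d y) * ((k - d y : ℕ) * H (d y)) = 0 := by
    calc ∑ y ∈ Y, F (d y) * ((k - d y : ℕ) * H (d y))
        = ∑ j ∈ range s, (g j : ℚ) * ∑ y ∈ Y, F (d y) * (k - d y).descFactorial (j + 1) := by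
          simp only [mul_sum]
          rw [sum_comm]
          refine sum_congr rfl fun y hy => ?_
          rw [hexp _ (hdk y hy), mul_sum]
          exact sum_congr rfl fun _ _ => by ring
      _ = 0 := sum_eq_zero fun j hj => by
          rw [horth (j + 1) (by omega) (mem_range.1 hj), mul_zero]
  have hterm : ∀ y ∈ Y, F (d y) * ((k - d y : ℕ) * H (d y)) =
      if d y = a then F a * ((k - a : ℕ) * H a) else 0 := by
    intro y hy
    split_ifs with h
    · rw [h]
    · rcases hd y hy with h1 | h1
      · simp [h1]
      · have : H (d y) = 0 := prod_eq_zero (mem_erase.2 ⟨h, h1⟩) (sub_self _)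
        simp [this]
  rw [sum_congr rfl hterm, ← sum_filter, sum_const, nsmul_eq_mul] at hzero
  have hcount : (#{y ∈ Y | d y = a} : ℚ) ≠ 0 := by
    obtain ⟨y, hy, hya⟩ := hay
    exact_mod_cast (card_pos.2 ⟨y, mem_filter.2 ⟨hy, hya⟩⟩).ne'
  have hHa : H a ≠ 0 := prod_ne_zero_iff.2 fun b hb =>
    sub_ne_zero.2 (Nat.cast_injective.ne (ne_of_mem_erase hb))
  have hka : ((k - a : ℕ) : ℚ) ≠ 0 := by
    have := hXk a ha
    exact_mod_cast (by omega : k - a ≠ 0)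
  simpa [hcount, hHa, hka] using hzero

theorem exists_int_eq_wilsonCoeff (hX : #X = s)
    (h : ∀ a ∈ X, ∑ i ∈ range (s + 1), wilsonCoeff k s i * a.descFactorial i = 0) {i : ℕ}
    (hi : i ≤ s) : ∃ z : ℤ, wilsonCoeff k s i = z := by
  obtain ⟨f, hf1, -, hf⟩ := exists_prod_sub_eq_sum_descFactorial X
  rcases hi.eq_or_lt with rfl | hi
  · exact ⟨1, by simp [wilsonCoeff_self]⟩
  · refine ⟨f i, sub_eq_zero.1 ?_⟩
    refine eq_zero_of_sum_mul_descFactorial_eq_zero (X := X)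
      (c := fun i => wilsonCoeff k s i - f i) (fun a ha => ?_) i (hX ▸ hi)
    have h1 := congrArg (Int.cast : ℤ → ℚ) (hf a)
    rw [prod_eq_zero ha (sub_self _)] at h1
    push_cast at h1
    have h2 := h a ha
    rw [← hX, sum_range_succ, hX, wilsonCoeff_self] at h2
    rw [sum_range_succ, hf1] at h1
    simp only [sub_mul, sum_sub_distrib]
    push_cast at h1
    rw [hX] at h1 ⊢
    linarith

theorem descFactorial_dvd_of_wilsonCoeff_int (hk : 2 * s < k)
    (h : ∀ i ≤ s, ∃ z : ℤ, wilsonCoeff k s i = z) {t : ℕ} (ht : t ≤ s) :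
    (2 * (k + 1 - s) + t - 1).descFactorial t ∣
      s.choose t * (k + 1 - s - 1 + t).descFactorial t * (k + 1 - s - 2 + t).descFactorial t := by
  obtain ⟨z, hz⟩ := h (s - t) (Nat.sub_le _ _)
  rw [wilsonCoeff, Nat.sub_sub_self ht, Nat.choose_symm ht,
    show k - (s - t) - 1 = k + 1 - s - 2 + t by omega, show k - (s - t) = k + 1 - s - 1 + t by omega,
    show 2 * k + 1 - s - (s - t) = 2 * (k + 1 - s) + t - 1 by omega] at hz
  have hne : ((2 * (k + 1 - s) + t - 1).descFactorial t : ℚ) ≠ 0 := by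
    rw [Nat.cast_ne_zero, Ne, Nat.descFactorial_eq_zero_iff_lt]
    omega
  rw [div_eq_iff hne] at hz
  rw [← Int.natCast_dvd_natCast]
  refine ⟨(-1) ^ t * z, ?_⟩
  have hsq : ((-1 : ℚ) ^ t) * (-1) ^ t = 1 := by rw [← mul_pow]; simp
  have hz' := congrArg (fun q : ℚ => (-1) ^ t * q) hz
  simp only [← mul_assoc, hsq, one_mul] at hz'
  have hq : ((s.choose t * (k + 1 - s - 1 + t).descFactorial t *
      (k + 1 - s - 2 + t).descFactorial t : ℕ) : ℚ) =
      ((2 * (k + 1 - s) + t - 1).descFactorial t : ℕ) * (((-1) ^ t * z : ℤ) : ℚ) := by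
    push_cast
    linarith
  exact_mod_cast hq

end WilsonIntegrality

section BlockCounts

variable {α : Type*} [DecidableEq α] {𝒞 : Finset (Finset α)} {k s : ℕ}

/-- The number of members of `𝒞` that contain `I` and are disjoint from `J`. -/
def blockCount (𝒞 : Finset (Finset α)) (I J : Finset α) : ℕ := #{y ∈ 𝒞 | I ⊆ y ∧ Disjoint J y}

theorem blockCount_insert_right {I J : Finset α} {p : α} :
    blockCount 𝒞 I (insert p J) + blockCount 𝒞 (insert p I) J = blockCount 𝒞 I J := by
  rw [blockCount, blockCount, blockCount, ← card_union_of_disjoint]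
  · congr 1
    ext y
    simp only [mem_union, mem_filter, disjoint_insert_left, insert_subset_iff]
    tauto
  · rw [Finset.disjoint_left]
    intro y
    simp only [mem_filter, disjoint_insert_left, insert_subset_iff]
    tauto

theorem sum_blockCount_insert_left [Fintype α] (hcard : ∀ x ∈ 𝒞, #x = k) (U : Finset α) :
    ∑ p ∈ Uᶜ, blockCount 𝒞 (insert p U) ∅ = (k - #U) * blockCount 𝒞 U ∅ := by
  simp only [blockCount, disjoint_empty_left, and_true, card_filter, insert_subset_iff]
  rw [sum_comm, mul_sum]
  refine sum_congr rfl fun y hy => ?_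
  by_cases hU : U ⊆ y
  · simp only [hU, and_true, if_true, mul_one]
    rw [← card_filter, ← hcard y hy, ← card_sdiff_of_subset hU]
    congr 1
    ext p
    simp only [mem_filter, mem_compl, mem_sdiff]
    tauto
  · simp [hU]

theorem exists_blockCount_empty_eq [Fintype α] (hv : k ≤ Fintype.card α)
    (hcard : ∀ x ∈ 𝒞, #x = k) {r n : ℕ} (hr : r < k)
    (hconst : ∀ U : Finset α, #U = r → blockCount 𝒞 U ∅ = n) :
    ∃ c : ℚ, ∀ U : Finset α, #U ≤ r →
      (blockCount 𝒞 U ∅ : ℚ) = c * (Fintype.card α - #U).choose (k - #U) := by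
  set v := Fintype.card α with hv'
  refine ⟨n / (v - r).choose (k - r), fun U hU => ?_⟩
  obtain ⟨d, hd⟩ := Nat.exists_eq_add_of_le' hU
  induction d generalizing U with
  | zero =>
    have hne : ((v - r).choose (k - r) : ℚ) ≠ 0 := by
      exact_mod_cast (Nat.choose_pos (by omega)).ne'
    rw [show #U = r by omega, hconst U (by omega), div_mul_cancel₀ _ hne]
  | succ d ih =>
    have h := congrArg (Nat.cast : ℕ → ℚ) (sum_blockCount_insert_left hcard U)
    rw [Nat.cast_sum, sum_congr rfl fun p hp => ih (insert p U)
      (by rw [card_insert_of_notMem (mem_compl.1 hp)]; omega)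
      (by rw [card_insert_of_notMem (mem_compl.1 hp)]; omega)] at h
    rw [sum_congr rfl fun p hp => by rw [card_insert_of_notMem (mem_compl.1 hp)], sum_const,
      card_compl, nsmul_eq_mul, ← hv'] at h
    have hchoose := Nat.add_one_mul_choose_eq (v - (#U + 1)) (k - (#U + 1))
    rw [show v - (#U + 1) + 1 = v - #U by omega, show k - (#U + 1) + 1 = k - #U by omega] at hchoose
    have hchoose' := congrArg (Nat.cast : ℕ → ℚ) hchoose
    have hku : ((k - #U : ℕ) : ℚ) ≠ 0 := by
      exact_mod_cast (by omega : k - #U ≠ 0)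
    push_cast at h hchoose'
    refine mul_left_cancel₀ hku ?_
    rw [← h]
    linear_combination (n / (v - r).choose (k - r) : ℚ) * hchoose'

theorem blockCount_eq [Fintype α] {r : ℕ} (hr : r < k) {c : ℚ} (hk : k ≤ Fintype.card α)
    (h : ∀ U : Finset α, #U ≤ r →
      (blockCount 𝒞 U ∅ : ℚ) = c * (Fintype.card α - #U).choose (k - #U))
    (J : Finset α) : ∀ I : Finset α, Disjoint I J → #I + #J ≤ r →
      (blockCount 𝒞 I J : ℚ) = c * (Fintype.card α - #I - #J).choose (k - #I) := by
  induction J using Finset.induction_on with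
  | empty => intro I _ hI; simpa using h I (by simpa using hI)
  | insert p J hp ih =>
    intro I hdisj hle
    rw [card_insert_of_notMem hp] at hle ⊢
    rw [disjoint_insert_right] at hdisj
    have h1 := ih I hdisj.2 (by omega)
    have h2 := ih (insert p I) (disjoint_insert_left.2 ⟨hp, hdisj.2⟩)
      (by rw [card_insert_of_notMem hdisj.1]; omega)
    rw [card_insert_of_notMem hdisj.1] at h2
    have h3 := congrArg (Nat.cast : ℕ → ℚ) (blockCount_insert_right (𝒞 := 𝒞) (I := I) (J := J) (p := p))
    rw [Nat.cast_add, h1, h2] at h3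
    have h4 := congrArg (Nat.cast : ℕ → ℚ)
      (Nat.choose_succ_succ' (Fintype.card α - #I - (#J + 1)) (k - (#I + 1)))
    rw [show Fintype.card α - #I - (#J + 1) + 1 = Fintype.card α - #I - #J by omega,
      show k - (#I + 1) + 1 = k - #I by omega] at h4
    push_cast at h4
    rw [h4, show Fintype.card α - (#I + 1) - #J = Fintype.card α - #I - (#J + 1) by omega] at h3
    linear_combination h3

theorem sum_descFactorial_mul_descFactorial_eq {x₀ : Finset α} (hx₀ : #x₀ = k) {r v : ℕ} {c : ℚ}
    (h : ∀ I J : Finset α, Disjoint I J → #I + #J ≤ r →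
      (blockCount 𝒞 I J : ℚ) = c * (v - #I - #J).choose (k - #I)) {i j : ℕ} (hij : i + j ≤ r) :
    ∑ y ∈ 𝒞, ((#(x₀ ∩ y)).descFactorial i * (k - #(x₀ ∩ y)).descFactorial j : ℚ) =
      c * (k.descFactorial i * (k - i).descFactorial j * (v - i - j).choose (k - i)) := by
  have hI : ∀ y, (#(x₀ ∩ y)).choose i = ∑ I ∈ powersetCard i x₀, if I ⊆ y then 1 else 0 := by
    intro y
    rw [← card_powersetCard, ← card_filter]
    congr 1
    ext I
    simp only [mem_powersetCard, mem_filter, subset_inter_iff]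
    tauto
  have hJ : ∀ y, (k - #(x₀ ∩ y)).choose j =
      ∑ J ∈ powersetCard j x₀, if Disjoint J y then 1 else 0 := by
    intro y
    rw [← card_filter, ← hx₀, inter_comm, ← card_sdiff, ← card_powersetCard]
    congr 1
    ext J
    simp only [mem_powersetCard, mem_filter, subset_sdiff]
    tauto
  have hpair : ∀ I ∈ powersetCard i x₀, ∑ J ∈ powersetCard j x₀, (blockCount 𝒞 I J : ℚ) =
      (k - i).choose j * (c * (v - i - j).choose (k - i)) := by
    intro I hI
    obtain ⟨hIx, hIi⟩ := mem_powersetCard.1 hI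
    have hsub : powersetCard j (x₀ \ I) ⊆ powersetCard j x₀ := powersetCard_mono sdiff_subset
    rw [← sum_subset hsub]
    · rw [sum_congr rfl fun J hJ => ?_, sum_const, card_powersetCard, card_sdiff_of_subset hIx, hx₀,
        hIi, nsmul_eq_mul]
      obtain ⟨h1, h2⟩ := mem_powersetCard.1 hJ
      rw [h I J (subset_sdiff.1 h1).2.symm (by omega), hIi, h2]
    · intro J hJ hJ'
      rw [Nat.cast_eq_zero, blockCount, card_eq_zero, filter_eq_empty_iff]
      rintro y - ⟨hIy, hJy⟩
      refine hJ' (mem_powersetCard.2 ⟨subset_sdiff.2 ⟨(mem_powersetCard.1 hJ).1, ?_⟩,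
        (mem_powersetCard.1 hJ).2⟩)
      exact hJy.mono_right hIy
  have hsum : ∑ y ∈ 𝒞, (((#(x₀ ∩ y)).choose i * (k - #(x₀ ∩ y)).choose j : ℕ) : ℚ) =
      ∑ I ∈ powersetCard i x₀, ∑ J ∈ powersetCard j x₀, (blockCount 𝒞 I J : ℚ) := by
    rw [← Nat.cast_sum]
    simp only [← Nat.cast_sum]
    congr 1
    simp only [hI, hJ, sum_mul_sum, blockCount, card_filter]
    rw [sum_comm]
    refine sum_congr rfl fun I _ => ?_
    rw [sum_comm]
    refine sum_congr rfl fun J _ => sum_congr rfl fun y _ => ?_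
    by_cases h1 : I ⊆ y <;> by_cases h2 : Disjoint J y <;> simp [h1, h2]
  rw [sum_congr rfl hpair, sum_const, card_powersetCard, hx₀, nsmul_eq_mul] at hsum
  simp only [Nat.descFactorial_eq_factorial_mul_choose]
  push_cast at hsum ⊢
  calc _ = (i.factorial * j.factorial : ℚ) *
      ∑ y ∈ 𝒞, ((#(x₀ ∩ y)).choose i * (k - #(x₀ ∩ y)).choose j : ℚ) := by
        rw [mul_sum]
        exact sum_congr rfl fun y _ => by ring
    _ = _ := by rw [hsum]; ring

end BlockCounts

section InclusionMatrix

variable {α : Type*} [DecidableEq α] {𝒞 : Finset (Finset α)} {k s : ℕ}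

theorem sum_powersetCard_choose_card_inter {i : ℕ} (hi : i ≤ s) (x y : Finset α) :
    ∑ T ∈ powersetCard s x, ∑ T' ∈ powersetCard s y, (#(T ∩ T')).choose i =
      (#(x ∩ y)).choose i * ((#x - i).choose (s - i) * (#y - i).choose (s - i)) := by
  have key : ∀ T ∈ powersetCard s x, ∀ T' ∈ powersetCard s y, (#(T ∩ T')).choose i =
      ∑ I ∈ powersetCard i (x ∩ y), (if I ⊆ T then 1 else 0) * (if I ⊆ T' then 1 else 0) := by
    intro T hT T' hT'
    rw [mem_powersetCard] at hT hT'
    simp only [ite_zero_mul_ite_zero, mul_one]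
    rw [← card_filter, ← card_powersetCard]
    congr 1
    ext I
    simp only [mem_powersetCard, mem_filter, subset_inter_iff]
    constructor
    · rintro ⟨⟨h1, h2⟩, h3⟩
      exact ⟨⟨⟨h1.trans hT.1, h2.trans hT'.1⟩, h3⟩, h1, h2⟩
    · rintro ⟨⟨-, h3⟩, h1, h2⟩
      exact ⟨⟨h1, h2⟩, h3⟩
  rw [sum_congr rfl fun T hT => sum_congr rfl (key T hT)]
  simp_rw [sum_comm (s := powersetCard s y), ← mul_sum]
  rw [sum_comm]
  simp_rw [← sum_mul]
  rw [← card_powersetCard, card_eq_sum_ones, sum_mul]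
  refine sum_congr rfl fun I hI => ?_
  rw [mem_powersetCard, subset_inter_iff] at hI
  rw [← card_filter, ← card_filter, card_filter_powersetCard_subset _ _ _ hI.1.1 (by omega),
    card_filter_powersetCard_subset _ _ _ hI.1.2 (by omega), hI.2, one_mul]

/-- The incidence matrix between members of `𝒞` and `s`-subsets of the ground set. -/
def inclusionMatrix (𝒞 : Finset (Finset α)) (s : ℕ) :
    Matrix {x // x ∈ 𝒞} {T : Finset α // #T = s} ℚ :=
  Matrix.of fun x T => if T.1 ⊆ x.1 then 1 else 0

/-- A matrix indexed by `s`-sets whose entries depend only on intersection sizes. -/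
def interMatrix (α : Type*) [DecidableEq α] (s : ℕ) (β : ℕ → ℚ) :
    Matrix {T : Finset α // #T = s} {T : Finset α // #T = s} ℚ :=
  Matrix.of fun T T' => β #(T.1 ∩ T'.1)

open Matrix in
theorem transpose_mul_inclusionMatrix_apply (T T' : {T : Finset α // #T = s}) :
    ((inclusionMatrix 𝒞 s)ᵀ * inclusionMatrix 𝒞 s) T T' = blockCount 𝒞 (T.1 ∪ T'.1) ∅ := by
  simp only [Matrix.mul_apply, transpose_apply, inclusionMatrix, of_apply, blockCount,
    disjoint_empty_left, and_true, card_filter, union_subset_iff, ite_zero_mul_ite_zero, mul_one]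
  push_cast
  exact Finset.sum_coe_sort 𝒞 fun y => if T.1 ⊆ y ∧ T'.1 ⊆ y then (1 : ℚ) else 0

variable [Fintype α]

theorem sum_ite_subset_eq (x : Finset α) (f : Finset α → ℚ) :
    ∑ T : {T : Finset α // #T = s}, (if T.1 ⊆ x then f T.1 else 0) =
      ∑ T ∈ powersetCard s x, f T := by
  rw [← Finset.sum_subtype (powersetCard s univ) (p := fun T : Finset α => #T = s)
    (by simp) (fun T => if T ⊆ x then f T else 0), ← sum_filter]
  refine sum_congr ?_ fun _ _ => rfl
  ext T
  simp only [mem_filter, mem_powersetCard, subset_univ, true_and]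
  tauto

open Matrix in
theorem exists_inclusionMatrix_mul_interMatrix_eq_one (hs : s ≤ k) (hcard : ∀ x ∈ 𝒞, #x = k)
    {X : Finset ℕ} (hX : #X = s) (hXk : ∀ a ∈ X, a < k)
    (hinter : ∀ x ∈ 𝒞, ∀ y ∈ 𝒞, x ≠ y → #(x ∩ y) ∈ X) :
    ∃ β : ℕ → ℚ, inclusionMatrix 𝒞 s * interMatrix α s β * (inclusionMatrix 𝒞 s)ᵀ = 1 := by
  obtain ⟨f, -, -, hf⟩ := exists_prod_sub_eq_sum_descFactorial X
  rw [hX] at hf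
  have hf' : ∀ x : ℕ, ∏ a ∈ X, ((x : ℚ) - a) =
      ∑ i ∈ range (s + 1), (f i : ℚ) * (i.factorial * x.choose i : ℕ) := by
    intro x
    have := congrArg (Int.cast : ℤ → ℚ) (hf x)
    push_cast at this
    rw [this]
    refine sum_congr rfl fun i _ => ?_
    rw [Nat.descFactorial_eq_factorial_mul_choose]
  have hk : ∏ a ∈ X, ((k : ℚ) - a) ≠ 0 := by
    refine prod_ne_zero_iff.2 fun a ha => sub_ne_zero.2 ?_
    exact_mod_cast (hXk a ha).ne'
  set F := ∏ a ∈ X, ((k : ℚ) - a) with hF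
  let g : ℕ → ℚ := fun i => f i * i.factorial / ((k - i).choose (s - i) : ℚ) ^ 2
  refine ⟨fun u => (∑ i ∈ range (s + 1), g i * u.choose i) / F, ?_⟩
  ext x y
  have hentry : (inclusionMatrix 𝒞 s * interMatrix α s
      (fun u => (∑ i ∈ range (s + 1), g i * u.choose i) / F) * (inclusionMatrix 𝒞 s)ᵀ) x y =
      (∏ a ∈ X, ((#(x.1 ∩ y.1) : ℚ) - a)) / F := by
    simp only [Matrix.mul_apply, transpose_apply, inclusionMatrix, interMatrix, of_apply,
      ite_mul, one_mul, zero_mul, mul_ite, mul_one, mul_zero]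
    rw [sum_ite_subset_eq y.1 fun T' => ∑ T : {T : Finset α // #T = s},
      if T.1 ⊆ x.1 then (∑ i ∈ range (s + 1), g i * (#(T.1 ∩ T')).choose i) / F else 0]
    rw [sum_congr rfl fun T' _ => sum_ite_subset_eq x.1
      fun T => (∑ i ∈ range (s + 1), g i * (#(T ∩ T')).choose i) / F]
    simp_rw [← sum_div, sum_comm (t := range (s + 1)), ← mul_sum]
    rw [hf']
    congr 1
    refine sum_congr rfl fun i hi => ?_
    have hi : i ≤ s := by simpa [Nat.lt_succ_iff] using hi
    have h := congrArg (Nat.cast : ℕ → ℚ) (sum_powersetCard_choose_card_inter hi x.1 y.1)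
    rw [hcard _ x.2, hcard _ y.2] at h
    push_cast at h
    rw [sum_comm, h]
    have : ((k - i).choose (s - i) : ℚ) ≠ 0 := by
      exact_mod_cast (Nat.choose_pos (by omega)).ne'
    push_cast
    simp only [g]
    field_simp
  rw [hentry]
  rcases eq_or_ne x y with rfl | hxy
  · rw [inter_self, hcard _ x.2, Matrix.one_apply_eq, div_self hk]
  · rw [Matrix.one_apply_ne hxy, div_eq_zero_iff]
    left
    exact prod_eq_zero (hinter _ x.2 _ y.2 fun h => hxy (Subtype.ext h)) (sub_self _)

open Matrix in
theorem card_le_choose_of_card_inter_mem (hs : s ≤ k) (hcard : ∀ x ∈ 𝒞, #x = k)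
    {X : Finset ℕ} (hX : #X = s) (hXk : ∀ a ∈ X, a < k)
    (hinter : ∀ x ∈ 𝒞, ∀ y ∈ 𝒞, x ≠ y → #(x ∩ y) ∈ X) :
    #𝒞 ≤ (Fintype.card α).choose s := by
  obtain ⟨β, hβ⟩ := exists_inclusionMatrix_mul_interMatrix_eq_one hs hcard hX hXk hinter
  have h := congrArg Matrix.rank hβ
  rw [Matrix.rank_one, Fintype.card_coe, Matrix.mul_assoc] at h
  rw [← h]
  exact (Matrix.rank_mul_le_left _ _).trans
    ((Matrix.rank_le_card_width _).trans (Fintype.card_finset_len s).le)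

open Matrix in
theorem blockCount_union_map_eq (hs : s ≤ k) (hcard : ∀ x ∈ 𝒞, #x = k)
    {X : Finset ℕ} (hX : #X = s) (hXk : ∀ a ∈ X, a < k)
    (hinter : ∀ x ∈ 𝒞, ∀ y ∈ 𝒞, x ≠ y → #(x ∩ y) ∈ X)
    (htight : #𝒞 = (Fintype.card α).choose s) (σ : Equiv.Perm α) {T T' : Finset α}
    (hT : #T = s) (hT' : #T' = s) :
    blockCount 𝒞 ((T ∪ T').map σ.toEmbedding) ∅ = blockCount 𝒞 (T ∪ T') ∅ := by
  obtain ⟨β, hβ⟩ := exists_inclusionMatrix_mul_interMatrix_eq_one hs hcard hX hXk hinter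
  set W := inclusionMatrix 𝒞 s
  set B := interMatrix α s β with hB
  have hcards : Fintype.card {x // x ∈ 𝒞} = Fintype.card {T : Finset α // #T = s} := by
    rw [Fintype.card_coe, htight, Fintype.card_finset_len]
  have hBG : B * (Wᵀ * W) = 1 := by
    rw [Matrix.mul_assoc, Matrix.mul_eq_one_comm_of_card_eq _ _ _ hcards, Matrix.mul_assoc] at hβ
    exact hβ
  let e : {T : Finset α // #T = s} ≃ {T : Finset α // #T = s} :=
    σ.finsetCongr.subtypeEquiv fun T => by simp
  have hBe : B.submatrix e e = B := by
    ext T T'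
    simp [hB, interMatrix, e, ← map_inter]
  have hBG' : B * (Wᵀ * W).submatrix e e = 1 := by
    have := congrArg (fun M => Matrix.submatrix M e e) hBG
    simp only [Matrix.submatrix_one_equiv] at this
    rwa [← Matrix.submatrix_mul_equiv _ _ _ e, hBe] at this
  have hG : (Wᵀ * W).submatrix e e = Wᵀ * W :=
    (left_inv_eq_right_inv (mul_eq_one_comm.1 hBG) hBG').symm
  have h := congrFun (congrFun hG ⟨T, hT⟩) ⟨T', hT'⟩
  rw [Matrix.submatrix_apply, transpose_mul_inclusionMatrix_apply,
    transpose_mul_inclusionMatrix_apply] at h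
  have h' := Nat.cast_injective h
  simpa [e, map_union] using h'

theorem blockCount_eq_of_card_eq (hs : s ≤ k) (hcard : ∀ x ∈ 𝒞, #x = k)
    {X : Finset ℕ} (hX : #X = s) (hXk : ∀ a ∈ X, a < k)
    (hinter : ∀ x ∈ 𝒞, ∀ y ∈ 𝒞, x ≠ y → #(x ∩ y) ∈ X)
    (htight : #𝒞 = (Fintype.card α).choose s) {U U' : Finset α} (hsU : s ≤ #U)
    (hU : #U ≤ 2 * s) (hUU' : #U = #U') :
    blockCount 𝒞 U ∅ = blockCount 𝒞 U' ∅ := by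
  obtain ⟨σ, rfl⟩ := Equiv.Perm.exists_map_finset_eq U U' hUU'
  obtain ⟨T, hTU, hT⟩ := exists_subset_card_eq hsU
  obtain ⟨T', hT'1, hT'2, hT'⟩ := exists_subsuperset_card_eq (n := s)
    (sdiff_subset : U \ T ⊆ U) (by rw [card_sdiff_of_subset hTU]; omega) hsU
  have : T ∪ T' = U := by
    refine subset_antisymm (union_subset hTU hT'2) fun a ha => ?_
    by_cases haT : a ∈ T
    · exact mem_union_left _ haT
    · exact mem_union_right _ (hT'1 (mem_sdiff.2 ⟨ha, haT⟩))
  rw [← this, blockCount_union_map_eq hs hcard hX hXk hinter htight σ hT hT']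

end InclusionMatrix

section TightCodes

theorem choose_two_mul_add_one_lt {k i j : ℕ} (hij : i < j) (hj : j ≤ k) :
    (2 * k + 1).choose i < (2 * k + 1).choose j := by
  induction j, hij using Nat.le_induction with
  | base =>
    have h := Nat.choose_succ_right_eq (2 * k + 1) i
    have hpos : 0 < (2 * k + 1).choose i := Nat.choose_pos (by omega)
    by_contra! hle
    have h1 := Nat.mul_le_mul_right (i + 1) hle
    rw [Nat.succ_eq_add_one, h] at h1
    have h2 := Nat.mul_lt_mul_of_pos_left (show i + 1 < 2 * k + 1 - i by omega) hpos
    exact h1.not_gt h2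
  | succ j hij ih =>
    exact (ih (by omega)).trans_le (Nat.choose_le_succ_of_lt_half_left (by omega))

variable {α : Type*} [DecidableEq α] [Fintype α] {𝒞 : Finset (Finset α)} {k s : ℕ}

theorem eq_one_or_eq_of_card_eq_choose (hα : Fintype.card α = 2 * k + 1) (hs : 1 ≤ s) (hsk : s ≤ k)
    (hcard : ∀ x ∈ 𝒞, #x = k) {X : Finset ℕ} (hX : #X = s) (hXk : ∀ a ∈ X, a < k)
    (hinter : ∀ x ∈ 𝒞, ∀ y ∈ 𝒞, x ≠ y → #(x ∩ y) ∈ X)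
    (hreal : ∀ a ∈ X, ∃ x ∈ 𝒞, ∃ y ∈ 𝒞, #(x ∩ y) = a)
    (htight : #𝒞 = (2 * k + 1).choose s) : s = 1 ∨ s = k := by
  have htight' : #𝒞 = (Fintype.card α).choose s := by rw [hα, htight]
  have hconst {U U' : Finset α} (hsU : s ≤ #U) (hU : #U ≤ 2 * s) (hUU' : #U = #U') :
      blockCount 𝒞 U ∅ = blockCount 𝒞 U' ∅ :=
    blockCount_eq_of_card_eq hsk hcard hX hXk hinter htight' hsU hU hUU'
  rcases le_or_gt k (2 * s) with hk | hk
  · right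
    by_contra hne
    have hall : powersetCard k univ ⊆ 𝒞 := by
      intro U hU
      rw [mem_powersetCard] at hU
      obtain ⟨x, hx⟩ : 𝒞.Nonempty := by
        rw [← card_pos, htight]
        exact Nat.choose_pos (by omega)
      have hpos : 0 < blockCount 𝒞 U ∅ := by
        rw [hconst (by omega) (by omega) (hU.2.trans (hcard x hx).symm), blockCount, card_pos]
        exact ⟨x, by simp [hx]⟩
      rw [blockCount, card_pos] at hpos
      obtain ⟨y, hy⟩ := hpos
      rw [mem_filter] at hy
      rw [eq_of_subset_of_card_le hy.2.1 (by rw [hU.2, hcard y hy.1])]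
      exact hy.1
    have h1 := card_le_card hall
    rw [card_powersetCard, card_univ, hα, htight] at h1
    exact h1.not_gt (choose_two_mul_add_one_lt (lt_of_le_of_ne hsk hne) le_rfl)
  · left
    by_contra hne
    obtain ⟨U₀, -, hU₀⟩ := exists_subset_card_eq (s := (univ : Finset α)) (n := 2 * s)
      (by rw [card_univ]; omega)
    have hkα : k ≤ Fintype.card α := by omega
    obtain ⟨c, hc⟩ := exists_blockCount_empty_eq (r := 2 * s) (n := blockCount 𝒞 U₀ ∅) hkα hcard hk
      fun U hU => hconst (by omega) hU.le (hU.trans hU₀.symm)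
    have hc' : ∀ I J : Finset α, Disjoint I J → #I + #J ≤ 2 * s →
        (blockCount 𝒞 I J : ℚ) = c * (2 * k + 1 - #I - #J).choose (k - #I) := fun I J => by
      rw [← hα]
      exact blockCount_eq hk hkα hc J I
    have hzero : ∀ a ∈ X, ∑ i ∈ range (s + 1), wilsonCoeff k s i * a.descFactorial i = 0 := by
      intro a ha
      obtain ⟨x, hx, y, hy, hxy⟩ := hreal a ha
      refine sum_wilsonCoeff_mul_descFactorial_eq_zero (Y := 𝒞) (d := fun y => #(x ∩ y)) hk hX hXk
        (fun y hy => ?_)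
        (fun i j hij => sum_descFactorial_mul_descFactorial_eq (hcard x hx) hc' hij) ha ⟨y, hy, hxy⟩
      rcases eq_or_ne x y with rfl | hne
      · left; rw [inter_self, hcard x hx]
      · right; exact hinter x hx y hy hne
    refine not_forall_descFactorial_dvd (s := s) (a := k + 1 - s) (by omega) (by omega) fun t ht =>
      descFactorial_dvd_of_wilsonCoeff_int hk (fun i hi => exists_int_eq_wilsonCoeff hX hzero hi) ht

end TightCodes

section Derived

variable {β : Type*} [DecidableEq β] [Fintype β] {n : ℕ} {z : β} {x y : Finset β}

/-- The one of `x` and its complement that contains `z`. -/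
def complTowards (z : β) (x : Finset β) : Finset β := if z ∈ x then x else xᶜ

theorem mem_complTowards : z ∈ complTowards z x := by
  unfold complTowards
  split_ifs with h <;> simp [h]

theorem card_complTowards_inter (hβ : Fintype.card β = 2 * n) (hx : #x = n) (hy : #y = n) :
    #(complTowards z x ∩ complTowards z y) = #(x ∩ y) ∨
      #(complTowards z x ∩ complTowards z y) = n - #(x ∩ y) := by
  unfold complTowards
  have hle : #(x ∩ y) ≤ n := hx ▸ card_le_card inter_subset_left
  split_ifs
  · exact Or.inl rfl
  · right
    rw [← sdiff_eq_inter_compl, card_sdiff, hx, inter_comm]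
  · right
    rw [inter_comm, ← sdiff_eq_inter_compl, card_sdiff, hy]
  · left
    rw [← compl_union, card_compl, card_union, hx, hy, hβ]
    omega

/-- The trace on the complement of `z` of the one of `x` and its complement that contains `z`. -/
def derivedBlock (z : β) (x : Finset β) : Finset {i // i ≠ z} :=
  (complTowards z x).subtype (· ≠ z)

theorem card_derivedBlock_inter :
    #(derivedBlock z x ∩ derivedBlock z y) + 1 = #(complTowards z x ∩ complTowards z y) := by
  have h : derivedBlock z x ∩ derivedBlock z y =
      (complTowards z x ∩ complTowards z y).subtype (· ≠ z) := by
    ext i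
    simp [derivedBlock]
  rw [h, card_subtype, filter_ne']
  exact card_erase_add_one (mem_inter.2 ⟨mem_complTowards, mem_complTowards⟩)

theorem card_derivedBlock (hβ : Fintype.card β = 2 * n) (hx : #x = n) :
    #(derivedBlock z x) + 1 = n := by
  rw [← inter_self (derivedBlock z x), card_derivedBlock_inter, inter_self, complTowards]
  split_ifs
  · exact hx
  · rw [card_compl, hx, hβ]
    omega

end Derived

section JohnsonCodes

variable {n : ℕ} {C : Finset (Finset (Fin (2 * n)))}

theorem sub_card_inter_mem_johnsonDistSet {x y : Finset (Fin (2 * n))} (hx : x ∈ C) (hy : y ∈ C)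
    (hxy : x ≠ y) : n - #(x ∩ y) ∈ johnsonDistSet n C :=
  mem_image.2 ⟨(x, y), mem_filter.2 ⟨mem_product.2 ⟨hx, hy⟩, hxy⟩, rfl⟩

theorem card_inter_lt (hcard : ∀ x ∈ C, #x = n) {x y : Finset (Fin (2 * n))} (hx : x ∈ C)
    (hy : y ∈ C) (hxy : x ≠ y) : #(x ∩ y) < n := by
  by_contra! h
  have h1 := eq_of_subset_of_card_le (inter_subset_left : x ∩ y ⊆ x) (by rw [hcard x hx]; exact h)
  have h2 := eq_of_subset_of_card_le (inter_subset_right : x ∩ y ⊆ y) (by rw [hcard y hy]; exact h)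
  exact hxy (h1.symm.trans h2)

theorem johnsonDistSet_subset_Ioo (hcard : ∀ x ∈ C, #x = n)
    (hsym : ∀ a ∈ johnsonDistSet n C, n - a ∈ johnsonDistSet n C) :
    johnsonDistSet n C ⊆ Ioo 0 n := by
  have h0 : ∀ a ∈ johnsonDistSet n C, 0 < a := by
    intro a ha
    obtain ⟨⟨x, y⟩, hxy, rfl⟩ := mem_image.1 ha
    rw [mem_filter, mem_product] at hxy
    exact Nat.sub_pos_of_lt (card_inter_lt hcard hxy.1.1 hxy.1.2 hxy.2)
  exact fun a ha => mem_Ioo.2 ⟨h0 a ha, Nat.lt_of_sub_pos (h0 _ (hsym a ha))⟩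

theorem card_derivedBlock_inter_add_one_mem (hcard : ∀ x ∈ C, #x = n)
    (hsym : ∀ a ∈ johnsonDistSet n C, n - a ∈ johnsonDistSet n C) (z : Fin (2 * n))
    {x y : Finset (Fin (2 * n))} (hx : x ∈ C) (hy : y ∈ C) (hxy : x ≠ y) :
    #(derivedBlock z x ∩ derivedBlock z y) + 1 ∈ johnsonDistSet n C := by
  have hmem := sub_card_inter_mem_johnsonDistSet hx hy hxy
  rw [card_derivedBlock_inter]
  rcases card_complTowards_inter (z := z) (Fintype.card_fin _) (hcard x hx) (hcard y hy) with h | h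
  · rw [h, ← Nat.sub_sub_self (card_inter_lt hcard hx hy hxy).le]
    exact hsym _ hmem
  · rwa [h]

theorem card_johnsonDistSet_eq_one_or (hn : 0 < n) (hcard : ∀ x ∈ C, #x = n)
    (hs : 1 ≤ #(johnsonDistSet n C))
    (hsym : ∀ a ∈ johnsonDistSet n C, n - a ∈ johnsonDistSet n C)
    (htight : #C = (2 * n - 1).choose #(johnsonDistSet n C)) :
    #(johnsonDistSet n C) = 1 ∨ #(johnsonDistSet n C) = n - 1 := by
  have hIoo := johnsonDistSet_subset_Ioo hcard hsym
  have hle : #(johnsonDistSet n C) ≤ n - 1 := by simpa using card_le_card hIoo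
  let z : Fin (2 * n) := ⟨0, by omega⟩
  have hblock : ∀ x ∈ C, #(derivedBlock z x) + 1 = n := fun x hx =>
    card_derivedBlock (Fintype.card_fin _) (hcard x hx)
  have hinter {x y} (hx : x ∈ C) (hy : y ∈ C) (hxy : x ≠ y) :
      #(derivedBlock z x ∩ derivedBlock z y) + 1 ∈ johnsonDistSet n C :=
    card_derivedBlock_inter_add_one_mem hcard hsym z hx hy hxy
  have hinj : Set.InjOn (derivedBlock z) C := by
    intro x hx y hy hxy
    by_contra hne
    have h := hinter hx hy hne
    rw [← hxy, inter_self, hblock x hx] at h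
    exact lt_irrefl _ (mem_Ioo.1 (hIoo h)).2
  set 𝒞 := C.image (derivedBlock z) with h𝒞
  have h𝒞card : #𝒞 = (2 * n - 1).choose #(johnsonDistSet n C) := by
    rw [h𝒞, card_image_of_injOn hinj, htight]
  have hα : Fintype.card {i // i ≠ z} = 2 * n - 1 := by simp
  have h𝒞k : ∀ x ∈ 𝒞, #x = n - 1 := by
    intro x hx
    obtain ⟨x, hxC, rfl⟩ := mem_image.1 hx
    have := hblock x hxC
    omega
  set X := 𝒞.offDiag.image fun p => #(p.1 ∩ p.2) with hXdef
  have hX : ∀ a ∈ X, a + 1 ∈ johnsonDistSet n C := by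
    intro a ha
    obtain ⟨⟨x, y⟩, hxy, rfl⟩ := mem_image.1 ha
    obtain ⟨hx, hy, hne⟩ := mem_offDiag.1 hxy
    obtain ⟨x', hx', h1⟩ := mem_image.1 hx
    obtain ⟨y', hy', h2⟩ := mem_image.1 hy
    rw [← h1, ← h2] at hne ⊢
    exact hinter hx' hy' fun h => hne (by rw [h])
  have hXk : ∀ a ∈ X, a < n - 1 := fun a ha => by
    have := (mem_Ioo.1 (hIoo (hX a ha))).2
    omega
  have hXi : ∀ x ∈ 𝒞, ∀ y ∈ 𝒞, x ≠ y → #(x ∩ y) ∈ X := fun x hx y hy hxy =>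
    mem_image.2 ⟨(x, y), mem_offDiag.2 ⟨hx, hy, hxy⟩, rfl⟩
  have hXr : ∀ a ∈ X, ∃ x ∈ 𝒞, ∃ y ∈ 𝒞, #(x ∩ y) = a := by
    intro a ha
    obtain ⟨⟨x, y⟩, hxy, rfl⟩ := mem_image.1 ha
    obtain ⟨hx, hy, -⟩ := mem_offDiag.1 hxy
    exact ⟨x, hx, y, hy, rfl⟩
  have hXle : #X ≤ #(johnsonDistSet n C) :=
    card_le_card_of_injOn (· + 1) hX fun a _ b _ h => Nat.succ_injective h
  have hn' : 2 * n - 1 = 2 * (n - 1) + 1 := by omega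
  have hXs : #X = #(johnsonDistSet n C) := by
    by_contra hne
    have h1 := card_le_choose_of_card_inter_mem (hXle.trans hle) h𝒞k rfl hXk hXi
    rw [hα, h𝒞card, hn'] at h1
    exact h1.not_gt (choose_two_mul_add_one_lt (lt_of_le_of_ne hXle hne) hle)
  exact eq_one_or_eq_of_card_eq_choose (hα.trans hn') hs hle h𝒞k hXs hXk hXi hXr
    (by rw [h𝒞card, hn'])

end JohnsonCodes

/-- A tight symmetric-distance Johnson code in `J(2n, n)` of degree `s ≥ 1`
satisfies `s = 1`, or `s = n − 1`, or `s > 0.9999995 n`. -/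
theorem stmt_4 (n : ℕ) (hn : 0 < n) (C : Finset (Finset (Fin (2 * n))))
    (hcard : ∀ x ∈ C, x.card = n)
    (hs : 1 ≤ (johnsonDistSet n C).card)
    (hsym : ∀ a ∈ johnsonDistSet n C, n - a ∈ johnsonDistSet n C)
    (htight : C.card = (2 * n - 1).choose (johnsonDistSet n C).card) :
    (johnsonDistSet n C).card = 1 ∨ (johnsonDistSet n C).card = n - 1 ∨
      (0.9999995 : ℝ) * (n : ℝ) < ((johnsonDistSet n C).card : ℝ) := by
  rcases card_johnsonDistSet_eq_one_or hn hcard hs hsym htight with h | h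
  · exact Or.inl h
  · exact Or.inr (Or.inl h)
end

section
/- Let n and s be positive integers with s ≤ n. Let R(2n, s−1) denote the set of vectors α ∈ {0,1}^{2n} with Σ_{i=1}^{2n} α_i ≤ s−1 and Σ_{i=1}^{2n} α_i ≡ s−1 (mod 2). For each α ∈ R(2n, s−1) define the function g_α : {−1,1}^{2n} → ℝ by g_α(v) = (Σ_{i=1}^{2n} v_i) · Π_{i=1}^{2n} v_i^{α_i}. Then the family {g_α : α ∈ R(2n, s−1)} is linearly independent in the real vector space of all functions from {−1,1}^{2n} to ℝ. -/
open Finset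

section SignVector

variable {ι : Type*} [DecidableEq ι]

/-- The point of the cube `{-1, 1}^ι` whose coordinates equal to `-1` are those in `T`. -/
def signVector (T : Finset ι) (i : ι) : ℝ := if i ∈ T then -1 else 1

lemma signVector_eq_or (T : Finset ι) (i : ι) : signVector T i = 1 ∨ signVector T i = -1 := by
  unfold signVector
  split_ifs <;> simp

lemma prod_signVector_comm (A B : Finset ι) :
    ∏ i ∈ A, signVector B i = ∏ i ∈ B, signVector A i := by
  simp only [signVector, Finset.prod_ite_mem, inter_comm]

lemma sum_signVector [Fintype ι] (T : Finset ι) :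
    ∑ i, signVector T i = Fintype.card ι - 2 * #T := by
  have h (i : ι) : signVector T i = 1 - 2 * if i ∈ T then (1 : ℝ) else 0 := by
    unfold signVector
    split_ifs <;> norm_num
  simp [h, mul_comm]

/-- The alternating sum of the character of `B` over the subcube of subsets of `A`. -/
lemma sum_powerset_prod_signVector (A B : Finset ι) :
    ∑ T ∈ A.powerset, (-1 : ℝ) ^ #T * ∏ i ∈ B, signVector T i =
      if A ⊆ B then 2 ^ #A else 0 := by
  have h : ∑ T ∈ A.powerset, (-1 : ℝ) ^ #T * ∏ i ∈ B, signVector T i =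
      ∏ i ∈ A, (-signVector B i + 1) := by
    rw [prod_add]
    refine sum_congr rfl fun T _ => ?_
    rw [prod_signVector_comm, prod_const_one, mul_one, prod_neg]
  rw [h]
  split_ifs with hAB
  · rw [← prod_const]
    refine prod_congr rfl fun i hi => ?_
    rw [signVector, if_pos (hAB hi)]
    norm_num
  · obtain ⟨i, hi, hiB⟩ := not_subset.mp hAB
    exact prod_eq_zero hi (by simp [signVector, hiB])

end SignVector

/-- The functions `g_α(v) = (∑ i, v i) ⬝ ∏_{i ∈ α} v i`, for `α` ranging over
the subsets of `{1, …, 2n}` of size at most `s − 1` and size congruent to `s − 1 mod 2`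
(encoding the 0-1 vectors `α ∈ R(2n, s−1)` by their supports), are linearly independent in
the space of real-valued functions on the cube `{−1, 1}^{2n}`. -/
theorem stmt_5 (n s : ℕ) (hn : 0 < n) (hs : 0 < s) (hsn : s ≤ n) :
    LinearIndependent ℝ
      (fun (α : {A : Finset (Fin (2 * n)) // A.card ≤ s - 1 ∧ A.card % 2 = (s - 1) % 2})
        (v : {v : Fin (2 * n) → ℝ // ∀ i, v i = 1 ∨ v i = -1}) =>
        (∑ i, v.1 i) * ∏ i ∈ α.1, v.1 i) := by
  rw [Fintype.linearIndependent_iff]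
  intro c hc
  by_contra! hne
  obtain ⟨A, hA, hmax⟩ := exists_max_image (univ.filter fun α => c α ≠ 0) (fun α => #α.1)
    (hne.imp fun α hα => by simpa using hα)
  simp only [mem_filter, mem_univ, true_and] at hA hmax
  have hvanish : ∀ T ∈ A.1.powerset, ∑ B, c B * ∏ i ∈ B.1, signVector T i = 0 := by
    intro T hT
    have hT' : #T < n := by
      have := card_le_card (mem_powerset.mp hT)
      have := A.2.1
      omega
    have hsum : ∑ i, signVector T i ≠ 0 := by
      have : (#T : ℝ) < n := by exact_mod_cast hT'
      rw [sum_signVector, Fintype.card_fin]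
      push_cast
      linarith
    have h := congrFun hc ⟨signVector T, signVector_eq_or T⟩
    simp only [Finset.sum_apply, Pi.smul_apply, smul_eq_mul, Pi.zero_apply,
      mul_left_comm (c _), ← mul_sum] at h
    exact (mul_eq_zero.mp h).resolve_left hsum
  have hzero : ∑ B, c B * (if A.1 ⊆ B.1 then (2 : ℝ) ^ #A.1 else 0) = 0 := by
    simp only [← sum_powerset_prod_signVector, mul_sum]
    rw [sum_comm]
    refine sum_eq_zero fun T hT => ?_
    simp only [mul_left_comm (c _), ← mul_sum, hvanish T hT, mul_zero]
  rw [sum_eq_single A ?_ (by simp)] at hzero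
  · simp [hA] at hzero
  · intro B _ hBA
    by_cases hB : c B = 0
    · simp [hB]
    · rw [if_neg, mul_zero]
      exact fun hAB => hBA (Subtype.ext (eq_of_subset_of_card_le hAB (hmax B hB)).symm)
end

section
/- Let n, s be positive integers with s ≤ n, and let C = {F_1, …, F_m} be a set of m distinct n-element subsets of {1,…,2n} whose distance set S(C) = {n − |F ∩ F'| : F, F' ∈ C, F ≠ F'} has size s and satisfies: a ∈ S(C) implies n − a ∈ S(C). For each 1 ≤ i ≤ m let v_i ∈ {−1,1}^{2n} be the signed characteristic vector of F_i, and define P_i : {−1,1}^{2n} → ℝ by P_i(x) = Π_{d ∈ S(C)} (⟨x, v_i⟩ − 2(n − 2d)). Let R(2n, s−1) = {α ∈ {0,1}^{2n} : Σ α_i ≤ s−1, Σ α_i ≡ s−1 (mod 2)} and for α ∈ R(2n, s−1) define g_α : {−1,1}^{2n} → ℝ by g_α(v) = (Σ_{i=1}^{2n} v_i) · Π_{i=1}^{2n} v_i^{α_i}. Then the functions {P_i : 1 ≤ i ≤ m} ∪ {g_α : α ∈ R(2n, s−1)} are linearly independent in the real vector space of functions from {−1,1}^{2n} to ℝ. 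-/
open Finset

/-- Weighted sum of the character of `A` over all subsets of `D`. -/
theorem sum_powerset_mul_prod_sign {ι : Type*} [DecidableEq ι] (A D : Finset ι) :
    ∑ B ∈ D.powerset, (-1 : ℝ) ^ B.card * ∏ j ∈ A, (if j ∈ B then (-1 : ℝ) else 1) =
      if D ⊆ A then 2 ^ D.card else 0 := by
  have h : ∀ B ∈ D.powerset,
      (-1 : ℝ) ^ B.card * ∏ j ∈ A, (if j ∈ B then (-1 : ℝ) else 1) =
        ∏ j ∈ B, (if j ∈ A then (1 : ℝ) else -1) := by
    intro B _
    rw [Finset.prod_ite_mem, Finset.inter_comm, ← Finset.prod_ite_mem, ← Finset.prod_const,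
      ← Finset.prod_mul_distrib]
    exact Finset.prod_congr rfl fun j _ => by split_ifs <;> norm_num
  rw [Finset.sum_congr rfl h, ← Finset.prod_one_add]
  split_ifs with hDA
  · rw [← Finset.prod_const]
    exact Finset.prod_congr rfl fun j hj => by rw [if_pos (hDA hj)]; norm_num
  · obtain ⟨j, hj, hjA⟩ := Finset.not_subset.mp hDA
    exact Finset.prod_eq_zero hj (by simp [hjA])

/-- A multilinear polynomial of degree at most `k` that vanishes at all sign vectors with at most
`k` negative entries is zero. -/
theorem eq_zero_of_sum_mul_prod_sign_eq_zero {ι : Type*} [Fintype ι] [DecidableEq ι] (k : ℕ)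
    (c : Finset ι → ℝ) (hc : ∀ A, k < A.card → c A = 0)
    (h : ∀ B : Finset ι, B.card ≤ k →
      ∑ A, c A * ∏ j ∈ A, (if j ∈ B then (-1 : ℝ) else 1) = 0) (D : Finset ι) :
    c D = 0 := by
  induction D using Finset.strongDownwardInductionOn (n := Fintype.card ι) with
  | H D ih =>
    by_cases hD : k < D.card
    · exact hc D hD
    have key : ∑ B ∈ D.powerset, (-1 : ℝ) ^ B.card *
        ∑ A, c A * ∏ j ∈ A, (if j ∈ B then (-1 : ℝ) else 1) = 0 :=
      Finset.sum_eq_zero fun B hB => by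
        rw [h B ((Finset.card_le_card (Finset.mem_powerset.mp hB)).trans (not_lt.mp hD)), mul_zero]
    simp_rw [Finset.mul_sum, mul_left_comm _ (c _)] at key
    rw [Finset.sum_comm] at key
    simp_rw [← Finset.mul_sum, sum_powerset_mul_prod_sign] at key
    rw [Finset.sum_eq_single D] at key
    · simpa using key
    · intro A _ hAD
      split_ifs with hDA
      · rw [ih (Finset.card_le_univ A) (hDA.ssubset_of_ne hAD.symm), zero_mul]
      · exact mul_zero _
    · simp
  | _ => exact Finset.card_le_univ _

/-- The inner product of the signed characteristic vectors of two finsets. -/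
theorem sum_sign_mul_sign {ι : Type*} [Fintype ι] [DecidableEq ι] (A B : Finset ι) :
    ∑ j, (if j ∈ A then (1 : ℝ) else -1) * (if j ∈ B then (1 : ℝ) else -1) =
      Fintype.card ι - 2 * A.card - 2 * B.card + 4 * (A ∩ B).card := by
  have h : ∀ j, (if j ∈ A then (1 : ℝ) else -1) * (if j ∈ B then (1 : ℝ) else -1) =
      1 - 2 * (if j ∈ A then 1 else 0) - 2 * (if j ∈ B then 1 else 0) +
        4 * (if j ∈ A ∩ B then 1 else 0) := by
    intro j
    by_cases hA : j ∈ A <;> by_cases hB : j ∈ B <;> simp [hA, hB] <;> norm_num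
  simp_rw [h, Finset.sum_add_distrib, Finset.sum_sub_distrib, ← Finset.mul_sum,
    Finset.sum_boole, Finset.filter_univ_mem]
  simp

/-- The entries of a signed characteristic vector sum to twice the cardinality minus the
dimension. -/
theorem sum_sign {ι : Type*} [Fintype ι] [DecidableEq ι] (A : Finset ι) :
    ∑ j, (if j ∈ A then (1 : ℝ) else -1) = 2 * A.card - Fintype.card ι := by
  have h := sum_sign_mul_sign A Finset.univ
  simp only [Finset.mem_univ, if_true, mul_one, Finset.card_univ, Finset.inter_univ] at h
  rw [h]
  ring

/-- Let `C = {F_1, …, F_m}` be distinct `n`-subsets of `{1, …, 2n}` whose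
distance set `S(C)` has size `s` and is symmetric (`a ∈ S(C) → n − a ∈ S(C)`). With
`v_i ∈ {−1,1}^{2n}` the signed characteristic vector of `F_i`, the polynomials
`P_i(x) = ∏_{d ∈ S(C)} (⟨x, v_i⟩ − 2(n − 2d))` together with the functions
`g_α(v) = (∑ i, v i) ⬝ ∏_{i ∈ α} v i` for `α ∈ R(2n, s − 1)` (encoded by supports) are
linearly independent as functions on the cube `{−1, 1}^{2n}`. -/
theorem stmt_6 (n s m : ℕ) (hn : 0 < n) (hs : 0 < s) (hsn : s ≤ n)
    (F : Fin m → Finset (Fin (2 * n))) (hFinj : Function.Injective F)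
    (hFcard : ∀ i, (F i).card = n)
    (S : Finset ℕ)
    (hS : S = ((Finset.univ ×ˢ Finset.univ).filter
        fun p : Fin m × Fin m => p.1 ≠ p.2).image fun p => n - (F p.1 ∩ F p.2).card)
    (hScard : S.card = s)
    (hsym : ∀ a ∈ S, n - a ∈ S) :
    LinearIndependent ℝ
      (Sum.elim
        (fun (i : Fin m) (x : {v : Fin (2 * n) → ℝ // ∀ j, v j = 1 ∨ v j = -1}) =>
          ∏ d ∈ S, ((∑ j, x.1 j * (if j ∈ F i then (1 : ℝ) else -1))
            - 2 * ((n : ℝ) - 2 * (d : ℝ))))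
        (fun (α : {A : Finset (Fin (2 * n)) // A.card ≤ s - 1 ∧ A.card % 2 = (s - 1) % 2})
          (v : {v : Fin (2 * n) → ℝ // ∀ j, v j = 1 ∨ v j = -1}) =>
          (∑ j, v.1 j) * ∏ j ∈ α.1, v.1 j)) := by
  rw [Fintype.linearIndependent_iff]
  intro g hg
  have eval (x : {v : Fin (2 * n) → ℝ // ∀ j, v j = 1 ∨ v j = -1}) := congrFun hg x
  simp only [Fintype.sum_sum_type, Sum.elim_inl, Sum.elim_inr, Finset.sum_apply,
    Pi.smul_apply, smul_eq_mul, Pi.zero_apply] at eval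
  have inner_eq (i k : Fin m) :
      ∑ j, (if j ∈ F i then (1 : ℝ) else -1) * (if j ∈ F k then (1 : ℝ) else -1) =
        2 * ((n : ℝ) - 2 * ((n - (F i ∩ F k).card : ℕ) : ℝ)) := by
    rw [sum_sign_mul_sign, hFcard, hFcard, Nat.cast_sub
      ((Finset.card_le_card Finset.inter_subset_left).trans (hFcard i).le)]
    simp
    ring
  have zero_notMem : 0 ∉ S := by
    rw [hS]
    simp only [Finset.mem_image, Finset.mem_filter, not_exists, not_and]
    rintro ⟨i, k⟩ ⟨_, hik⟩ h
    have hle : n ≤ (F i ∩ F k).card := Nat.sub_eq_zero_iff_le.mp h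
    have hi := Finset.eq_of_subset_of_card_le
      (Finset.inter_subset_left (s₁ := F i) (s₂ := F k)) ((hFcard i).trans_le hle)
    have hk := Finset.eq_of_subset_of_card_le
      (Finset.inter_subset_right (s₁ := F i) (s₂ := F k)) ((hFcard k).trans_le hle)
    exact hik (hFinj (hi.symm.trans hk))
  have hP (i : Fin m) : g (Sum.inl i) = 0 := by
    have e := eval ⟨fun j => if j ∈ F i then 1 else -1, fun j => by dsimp only; split_ifs <;> simp⟩
    simp only [inner_eq, sum_sign, hFcard, Fintype.card_fin] at e
    rw [Finset.sum_eq_single i] at e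
    · simp only [Nat.cast_mul, Nat.cast_ofNat, sub_self, zero_mul, mul_zero,
        Finset.sum_const_zero, add_zero, mul_eq_zero, Finset.prod_eq_zero_iff] at e
      refine e.resolve_right ?_
      rintro ⟨d, hd, h⟩
      rw [Finset.inter_self, hFcard, Nat.sub_self] at h
      refine zero_notMem ?_
      have : (d : ℝ) = 0 := by push_cast at h; linarith
      rwa [← Nat.cast_eq_zero (R := ℝ).mp this]
    · intro k _ hki
      rw [Finset.prod_eq_zero (i := n - (F i ∩ F k).card), mul_zero]
      · rw [hS]
        exact Finset.mem_image.mpr ⟨(i, k), by simp [hki.symm], rfl⟩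
      · exact sub_self _
    · simp
  let c (A : Finset (Fin (2 * n))) : ℝ :=
    if h : A.card ≤ s - 1 ∧ A.card % 2 = (s - 1) % 2 then g (Sum.inr ⟨A, h⟩) else 0
  have hc : ∀ A, c A = 0 := by
    refine eq_zero_of_sum_mul_prod_sign_eq_zero (s - 1) c
      (fun A hA => dif_neg fun h => absurd h.1 (not_le.mpr hA)) fun B hB => ?_
    have e := eval ⟨fun j => if j ∈ B then -1 else 1, fun j => by dsimp only; split_ifs <;> simp⟩
    have hsum : ∑ j, (if j ∈ B then (-1 : ℝ) else 1) ≠ 0 := by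
      have h : ∑ j, (if j ∈ B then (-1 : ℝ) else 1) = 2 * n - 2 * B.card := by
        have := sum_sign Bᶜ
        simp only [Finset.mem_compl, ite_not] at this
        rw [this, Finset.card_compl, Nat.cast_sub (Finset.card_le_univ B)]
        simp
        ring
      have hlt : (B.card : ℝ) < n := by exact_mod_cast (by omega : B.card < n)
      rw [h]
      linarith
    simp only [hP, zero_mul, Finset.sum_const_zero, zero_add, mul_left_comm (g _)] at e
    rw [← Finset.mul_sum] at e
    refine Eq.trans ?_ ((mul_eq_zero.mp e).resolve_left hsum)
    rw [← Finset.sum_filter_of_ne (p := fun A => A.card ≤ s - 1 ∧ A.card % 2 = (s - 1) % 2)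
      fun A _ hA => by_contra fun h => left_ne_zero_of_mul hA (dif_neg h),
      Finset.sum_subtype _ fun A => Finset.mem_filter_univ A]
    exact Finset.sum_congr rfl fun A _ => by rw [show c A = g (Sum.inr A) from dif_pos A.2]
  rintro (i | ⟨A, hA⟩)
  · exact hP i
  · simpa [c, hA] using hc A
end

section
/- Let r, s be positive integers and n = r + s. Let (v_i)_{0 ≤ i ≤ s} be the sequence of real polynomials determined by v_0(x) = 1, v_1(x) = x, and the three-term recursion x·v_i(x) = [(2n−1)(i+1)(n−i) / (n(2n−2i−1))]·v_{i+1}(x) + [(2n−1)(n−i+1)(2n−i+2) / (n(2n−2i+3))]·v_{i−1}(x) for 1 ≤ i ≤ s−1. Define Ψ_s(x) = Σ_{0 ≤ i ≤ s, i ≡ s (mod 2)} v_i(x) and θ_z = (2n−1)(1 − 2z/n). Then for every real number z, Ψ_s(θ_z) = (2^{2s}/s!) · ((n−1/2)^{\underline{s}} / n^{\underline{s}}) · Φ_s(z), where a^{\underline{s}} = a(a−1)⋯(a−s+1) is the falling factorial of a real number a. -/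
open Finset Polynomial

/-- The coefficient `p_{s,i} = (C(s,i)/2^i) ⬝ (r+i−1)^{↓⌊i/2⌋} (r+1)^{↑i} / (r+1/2)^{↑⌊i/2⌋}`. -/
noncomputable def pcoef (r s i : ℕ) : ℚ :=
  (s.choose i : ℚ) / 2 ^ i *
    ((descPochhammer ℚ (i / 2)).eval ((r : ℚ) + i - 1) *
      (ascPochhammer ℚ i).eval ((r : ℚ) + 1)) /
    (ascPochhammer ℚ (i / 2)).eval ((r : ℚ) + 1 / 2)

/-- The polynomial `Φ_s(z) = ∑_{i=0}^{s} (−1)^{s−i} z^{↓(s−i)} p_{s,i} ∈ ℚ[z]`. -/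
noncomputable def Phi (r s : ℕ) : Polynomial ℚ :=
  ∑ i ∈ Finset.range (s + 1),
    Polynomial.C ((-1) ^ (s - i) * pcoef r s i) * descPochhammer ℚ (s - i)

open Nat in
/-- Common factor of the coefficients of `z^{↓k}`. -/
noncomputable def commonCoef (n k : ℕ) : ℝ :=
  (-1) ^ k * (2 * n)! * ((n - k)! : ℝ) ^ 2 / (((n)! : ℝ) ^ 2 * (k)!)

open Nat in
/-- The coefficient of `z^{↓k}` in `v_i(θ_z)`. -/
noncomputable def dualCoef (n i k : ℕ) : ℝ :=
  if k ≤ i then commonCoef n k * (2 * n + 1 - 2 * i) / ((i - k)! * (2 * n + 1 - i - k)!) else 0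

open Nat in
/-- The coefficient of `z^{↓k}` in the sum of the `v_i(θ_z)` with `i ≤ s` and `i ≡ s (mod 2)`. -/
noncomputable def parityCoef (n s k : ℕ) : ℝ :=
  if k ≤ s then commonCoef n k / (2 * ((n : ℝ) - k) * ((s - k)! * (2 * n - 1 - s - k)!)) else 0

lemma commonCoef_eq_mul_succ {n k : ℕ} (h : k < n) :
    commonCoef n k = -(((n : ℝ) - k) ^ 2 * (k + 1)) * commonCoef n (k + 1) := by
  obtain ⟨d, rfl⟩ := Nat.exists_eq_add_of_lt h
  have h1 : k + d + 1 - k = d + 1 := by omega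
  have h2 : k + d + 1 - (k + 1) = d := by omega
  have hk := Nat.factorial_ne_zero (k + d + 1)
  simp only [commonCoef, h1, h2, Nat.factorial_succ k, Nat.factorial_succ d]
  push_cast
  field_simp
  ring

lemma parityCoef_add_two {n s : ℕ} (h : s + 2 < n) (k : ℕ) :
    parityCoef n (s + 2) k = parityCoef n s k + dualCoef n (s + 2) k := by
  unfold parityCoef dualCoef
  rcases Nat.lt_or_ge (s + 2) k with hk | hk
  · simp [show ¬ k ≤ s + 2 by omega, show ¬ k ≤ s by omega]
  rcases Nat.lt_or_ge s k with hk' | hk'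
  · have hn : (n : ℝ) - k ≠ 0 := sub_ne_zero.2 (by exact_mod_cast (show n ≠ k by omega))
    rw [if_pos hk, if_neg (by omega), if_pos hk]
    obtain rfl | rfl : k = s + 1 ∨ k = s + 2 := by omega
    · obtain ⟨d, rfl⟩ := Nat.exists_eq_add_of_lt h
      rw [show s + 2 - (s + 1) = 1 by omega,
        show 2 * (s + 2 + d + 1) - 1 - (s + 2) - (s + 1) = 2 * d + 2 by omega,
        show 2 * (s + 2 + d + 1) + 1 - (s + 2) - (s + 1) = 2 * d + 2 + 1 + 1 by omega]
      simp only [Nat.factorial_succ (2 * d + 2 + 1), Nat.factorial_succ (2 * d + 2)]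
      push_cast at hn ⊢
      field_simp
      ring
    · obtain ⟨d, rfl⟩ := Nat.exists_eq_add_of_lt h
      rw [show 2 * (s + 2 + d + 1) - 1 - (s + 2) - (s + 2) = 2 * d + 1 by omega,
        show 2 * (s + 2 + d + 1) + 1 - (s + 2) - (s + 2) = 2 * d + 1 + 1 + 1 by omega]
      simp only [Nat.factorial_succ (2 * d + 1 + 1), Nat.factorial_succ (2 * d + 1)]
      push_cast at hn ⊢
      field_simp
      ring
  · have hn : (n : ℝ) - k ≠ 0 := sub_ne_zero.2 (by exact_mod_cast (show n ≠ k by omega))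
    rw [if_pos hk, if_pos hk', if_pos hk]
    obtain ⟨a, rfl⟩ := Nat.exists_eq_add_of_le hk'
    obtain ⟨d, rfl⟩ := Nat.exists_eq_add_of_lt h
    rw [show k + a - k = a by omega, show k + a + 2 - k = a + 1 + 1 by omega,
      show 2 * (k + a + 2 + d + 1) - 1 - (k + a) - k = a + 2 * d + 3 + 1 + 1 by omega,
      show 2 * (k + a + 2 + d + 1) - 1 - (k + a + 2) - k = a + 2 * d + 3 by omega,
      show 2 * (k + a + 2 + d + 1) + 1 - (k + a + 2) - k = a + 2 * d + 3 + 1 + 1 by omega]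
    simp only [Nat.factorial_succ (a + 2 * d + 3 + 1), Nat.factorial_succ (a + 2 * d + 3),
      Nat.factorial_succ (a + 1), Nat.factorial_succ a]
    push_cast at hn ⊢
    field_simp
    ring

/-- The three-term recursion at the level of coefficients: constant terms. -/
lemma dualCoef_recurrence_zero {n i : ℕ} (hi : i + 2 < n) :
    (2 * (n : ℝ) - 1) * dualCoef n (i + 1) 0 =
      (2 * n - 1) * ((i + 1 : ℕ) + 1) * (n - (i + 1 : ℕ)) / (n * (2 * n - 2 * (i + 1 : ℕ) - 1)) *
          dualCoef n (i + 2) 0 +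
        (2 * n - 1) * (n - (i + 1 : ℕ) + 1) * (2 * n - (i + 1 : ℕ) + 2) /
          (n * (2 * n - 2 * (i + 1 : ℕ) + 3)) * dualCoef n i 0 := by
  obtain ⟨d, rfl⟩ := Nat.exists_eq_add_of_lt hi
  have h1 : (2 * ((i + 2 + d + 1 : ℕ) : ℝ) - 2 * (i + 1 : ℕ) - 1) = 2 * d + 3 := by
    push_cast; ring
  have h2 : (2 * ((i + 2 + d + 1 : ℕ) : ℝ) - 2 * (i + 1 : ℕ) + 3) = 2 * d + 7 := by
    push_cast; ring
  rw [h1, h2]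
  simp only [dualCoef, Nat.zero_le, if_true, Nat.sub_zero]
  rw [show 2 * (i + 2 + d + 1) + 1 - i = i + 2 * d + 5 + 1 + 1 by omega,
    show 2 * (i + 2 + d + 1) + 1 - (i + 1) = i + 2 * d + 5 + 1 by omega,
    show 2 * (i + 2 + d + 1) + 1 - (i + 2) = i + 2 * d + 5 by omega]
  simp only [Nat.factorial_succ (i + 2 * d + 5 + 1), Nat.factorial_succ (i + 2 * d + 5),
    Nat.factorial_succ (i + 1), Nat.factorial_succ i]
  push_cast
  field_simp
  ring

/-- The three-term recursion at the level of coefficients: higher terms. -/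
lemma dualCoef_recurrence_succ {n i : ℕ} (hi : i + 2 < n) (k : ℕ) :
    (2 * (n : ℝ) - 1) * ((1 - 2 * (k + 1) / n) * dualCoef n (i + 1) (k + 1) -
        2 / n * dualCoef n (i + 1) k) =
      (2 * n - 1) * ((i + 1 : ℕ) + 1) * (n - (i + 1 : ℕ)) / (n * (2 * n - 2 * (i + 1 : ℕ) - 1)) *
          dualCoef n (i + 2) (k + 1) +
        (2 * n - 1) * (n - (i + 1 : ℕ) + 1) * (2 * n - (i + 1 : ℕ) + 2) /
          (n * (2 * n - 2 * (i + 1 : ℕ) + 3)) * dualCoef n i (k + 1) := by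
  rcases Nat.lt_or_ge (i + 1) k with hk | hk
  · simp [dualCoef, show ¬ k ≤ i + 1 by omega, show ¬ k + 1 ≤ i by omega,
      show ¬ k ≤ i by omega]
  have hc := commonCoef_eq_mul_succ (show k < n by omega)
  obtain ⟨d, rfl⟩ := Nat.exists_eq_add_of_lt hi
  have h1 : (2 * ((i + 2 + d + 1 : ℕ) : ℝ) - 2 * (i + 1 : ℕ) - 1) = 2 * d + 3 := by
    push_cast; ring
  have h2 : (2 * ((i + 2 + d + 1 : ℕ) : ℝ) - 2 * (i + 1 : ℕ) + 3) = 2 * d + 7 := by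
    push_cast; ring
  rw [h1, h2]
  unfold dualCoef
  rw [hc]
  generalize commonCoef (i + 2 + d + 1) (k + 1) = c
  clear hc h1 h2
  obtain rfl | rfl | hk' : k = i + 1 ∨ k = i ∨ k + 1 ≤ i := by omega
  · rw [if_neg (by omega), if_pos le_rfl, if_pos le_rfl, if_neg (by omega)]
    rw [show 2 * (i + 2 + d + 1) + 1 - (i + 1) - (i + 1) = 2 * d + 4 + 1 by omega,
      show 2 * (i + 2 + d + 1) + 1 - (i + 2) - (i + 1 + 1) = 2 * d + 3 by omega]
    simp only [Nat.factorial_succ (2 * d + 4), Nat.factorial_succ (2 * d + 3), Nat.sub_self]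
    push_cast
    field_simp
    ring
  · rw [if_pos le_rfl, if_pos (by omega), if_pos (by omega), if_neg (by omega)]
    rw [show 2 * (k + 2 + d + 1) + 1 - (k + 1) - (k + 1) = 2 * d + 4 + 1 by omega,
      show 2 * (k + 2 + d + 1) + 1 - (k + 2) - (k + 1) = 2 * d + 4 by omega,
      show 2 * (k + 2 + d + 1) + 1 - (k + 1) - k = 2 * d + 4 + 1 + 1 by omega,
      show k + 2 - (k + 1) = 1 by omega, show k + 1 - k = 1 by omega]
    simp only [Nat.factorial_succ (2 * d + 4), Nat.factorial_succ (2 * d + 4 + 1), Nat.sub_self]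
    push_cast
    field_simp
    ring
  · obtain ⟨a, rfl⟩ := Nat.exists_eq_add_of_le hk'
    rw [if_pos (by omega), if_pos (by omega), if_pos (by omega), if_pos (by omega)]
    rw [show k + 1 + a + 1 - (k + 1) = a + 1 by omega, show k + 1 + a + 1 - k = a + 1 + 1 by omega,
      show k + 1 + a + 2 - (k + 1) = a + 1 + 1 by omega, show k + 1 + a - (k + 1) = a by omega,
      show 2 * (k + 1 + a + 2 + d + 1) + 1 - (k + 1 + a + 1) - (k + 1) = a + 2 * d + 5 + 1 by omega,
      show 2 * (k + 1 + a + 2 + d + 1) + 1 - (k + 1 + a + 1) - k = a + 2 * d + 5 + 1 + 1 by omega,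
      show 2 * (k + 1 + a + 2 + d + 1) + 1 - (k + 1 + a + 2) - (k + 1) = a + 2 * d + 5 by omega,
      show 2 * (k + 1 + a + 2 + d + 1) + 1 - (k + 1 + a) - (k + 1) = a + 2 * d + 5 + 1 + 1 by omega]
    simp only [Nat.factorial_succ (a + 2 * d + 5 + 1), Nat.factorial_succ (a + 2 * d + 5),
      Nat.factorial_succ (a + 1), Nat.factorial_succ a]
    push_cast
    field_simp
    ring

lemma sum_filter_mod_two_add_two {M : Type*} [AddCommMonoid M] (f : ℕ → M) (s : ℕ) :
    ∑ i ∈ (range (s + 2 + 1)).filter (fun i => i % 2 = (s + 2) % 2), f i =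
      ∑ i ∈ (range (s + 1)).filter (fun i => i % 2 = s % 2), f i + f (s + 2) := by
  rw [sum_filter, sum_filter, sum_range_succ, sum_range_succ, if_pos rfl,
    if_neg (by omega), add_zero]
  simp

lemma parityCoef_eq_sum {n s : ℕ} (h : s < n) (k : ℕ) :
    ∑ i ∈ (range (s + 1)).filter (fun i => i % 2 = s % 2), dualCoef n i k = parityCoef n s k := by
  induction s using Nat.twoStepInduction with
  | zero =>
    obtain ⟨d, rfl⟩ := Nat.exists_eq_add_of_lt h
    simp only [sum_filter, zero_add, sum_range_one, if_true, dualCoef, parityCoef]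
    rcases k with _ | k
    · rw [show 2 * (d + 1) + 1 - 0 - 0 = 2 * d + 1 + 1 + 1 by omega,
        show 2 * (d + 1) - 1 - 0 - 0 = 2 * d + 1 by omega]
      simp only [Nat.factorial_succ (2 * d + 1 + 1), Nat.factorial_succ (2 * d + 1),
        le_refl, if_true]
      push_cast
      field_simp
      ring
    · simp
  | one =>
    obtain ⟨d, rfl⟩ := Nat.exists_eq_add_of_lt h
    simp only [sum_filter, sum_range_succ, sum_range_zero, dualCoef, parityCoef]
    rcases k with _ | _ | k
    · rw [show 2 * (1 + d + 1) + 1 - 1 - 0 = 2 * d + 2 + 1 + 1 by omega,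
        show 2 * (1 + d + 1) - 1 - 1 - 0 = 2 * d + 2 by omega]
      simp only [Nat.factorial_succ (2 * d + 2 + 1), Nat.factorial_succ (2 * d + 2)]
      norm_num
      field_simp
      ring
    · rw [show 2 * (1 + d + 1) + 1 - 1 - (0 + 1) = 2 * d + 1 + 1 + 1 by omega,
        show 2 * (1 + d + 1) - 1 - 1 - (0 + 1) = 2 * d + 1 by omega]
      simp only [Nat.factorial_succ (2 * d + 1 + 1), Nat.factorial_succ (2 * d + 1)]
      have : 1 + (d : ℝ) + 1 - 1 ≠ 0 := by ring_nf; positivity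
      norm_num
      field_simp
      ring
    · simp
  | more s ih _ =>
    rw [sum_filter_mod_two_add_two, ih (by omega), parityCoef_add_two h]

/-- The polynomials `v_i` at `θ_z` in the basis of falling factorials of `z`. -/
lemma dual_eval_eq_sum {n s : ℕ} (hn : s < n) (v : ℕ → Polynomial ℝ)
    (hv0 : v 0 = 1) (hv1 : v 1 = X)
    (hrec : ∀ i, 1 ≤ i → i ≤ s - 1 →
      X * v i =
        C ((2 * (n : ℝ) - 1) * ((i : ℝ) + 1) * ((n : ℝ) - i) /
            ((n : ℝ) * (2 * (n : ℝ) - 2 * i - 1))) * v (i + 1) +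
        C ((2 * (n : ℝ) - 1) * ((n : ℝ) - i + 1) * (2 * (n : ℝ) - i + 2) /
            ((n : ℝ) * (2 * (n : ℝ) - 2 * i + 3))) * v (i - 1)) (z : ℝ) (i : ℕ) (hi : i ≤ s) :
    (v i).eval ((2 * (n : ℝ) - 1) * (1 - 2 * z / n)) =
      ∑ k ∈ range (n + 1), dualCoef n i k * (descPochhammer ℝ k).eval z := by
  induction i using Nat.twoStepInduction with
  | zero =>
    rw [sum_eq_single_of_mem 0 (by simp) (fun k _ hk => by simp [dualCoef, hk])]
    have h := Nat.factorial_succ (2 * n)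
    simp [hv0, dualCoef, commonCoef, h]
    field_simp
  | one =>
    rw [← sum_subset (range_subset_range.2 (show 2 ≤ n + 1 by omega))
      (fun k _ hk => by
        rw [mem_range, not_lt] at hk
        simp [dualCoef, show ¬ k ≤ 1 by omega])]
    obtain ⟨d, rfl⟩ := Nat.exists_eq_add_of_le (show 1 ≤ n by omega)
    rw [hv1, eval_X, sum_range_succ, sum_range_one]
    simp only [dualCoef, commonCoef, descPochhammer_zero, descPochhammer_one, eval_X, eval_one]
    rw [show 2 * (1 + d) + 1 - 1 - 0 = 2 * d + 1 + 1 by omega,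
      show 2 * (1 + d) + 1 - 1 - 1 = 2 * d + 1 by omega,
      show 2 * (1 + d) = 2 * d + 1 + 1 by omega, show 1 + d - 1 = d by omega,
      show 1 + d - 0 = d + 1 by omega, show 1 + d = d + 1 by omega]
    simp only [Nat.factorial_succ d, Nat.factorial_succ (2 * d + 1), zero_le, le_refl, if_true]
    simp
    field_simp
    ring
  | more i ih0 ih1 =>
    have h := congrArg (eval ((2 * (n : ℝ) - 1) * (1 - 2 * z / n))) (hrec (i + 1) (by omega)
      (by omega))
    rw [Nat.add_sub_cancel] at h
    simp only [eval_mul, eval_X, eval_add, eval_C] at h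
    rw [ih0 (by omega), ih1 (by omega)] at h
    have hlt : i + 2 < n := by omega
    have key : (2 * (n : ℝ) - 1) * (1 - 2 * z / n) *
        ∑ k ∈ range (n + 1), dualCoef n (i + 1) k * (descPochhammer ℝ k).eval z =
        (2 * (n : ℝ) - 1) * ((i + 1 : ℕ) + 1) * (n - (i + 1 : ℕ)) /
            (n * (2 * n - 2 * (i + 1 : ℕ) - 1)) *
          ∑ k ∈ range (n + 1), dualCoef n (i + 2) k * (descPochhammer ℝ k).eval z +
        (2 * n - 1) * (n - (i + 1 : ℕ) + 1) * (2 * n - (i + 1 : ℕ) + 2) /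
          (n * (2 * n - 2 * (i + 1 : ℕ) + 3)) *
          ∑ k ∈ range (n + 1), dualCoef n i k * (descPochhammer ℝ k).eval z := by
      have hlast : dualCoef n (i + 1) n = 0 := by
        rw [dualCoef, if_neg (by omega)]
      have hmul : (1 - 2 * z / n) *
          ∑ k ∈ range (n + 1), dualCoef n (i + 1) k * (descPochhammer ℝ k).eval z =
          ∑ k ∈ range (n + 1), (1 - 2 * k / n) * dualCoef n (i + 1) k *
              (descPochhammer ℝ k).eval z -
            ∑ k ∈ range n, 2 / n * dualCoef n (i + 1) k * (descPochhammer ℝ (k + 1)).eval z := by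
        rw [show ∑ k ∈ range n, 2 / n * dualCoef n (i + 1) k * (descPochhammer ℝ (k + 1)).eval z =
            ∑ k ∈ range (n + 1), 2 / n * dualCoef n (i + 1) k * (descPochhammer ℝ (k + 1)).eval z by
          rw [sum_range_succ _ n, hlast]; simp, ← sum_sub_distrib, mul_sum]
        refine sum_congr rfl fun k _ => ?_
        rw [descPochhammer_succ_eval]
        ring
      rw [mul_assoc, hmul, sum_range_succ' _ n, sum_range_succ' _ n, sum_range_succ' _ n,
        add_sub_right_comm, ← sum_sub_distrib, mul_add (2 * (n : ℝ) - 1),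
        mul_add (_ / _), mul_add (_ / _), mul_sum, mul_sum,
        mul_sum, add_add_add_comm, ← sum_add_distrib]
      congr 1
      · refine sum_congr rfl fun k _ => ?_
        rw [← mul_assoc, ← mul_assoc, ← add_mul, ← dualCoef_recurrence_succ hlt k]
        push_cast
        ring
      · rw [← mul_assoc (_ / _), ← mul_assoc (_ / _), ← add_mul, ← dualCoef_recurrence_zero hlt]
        push_cast
        ring
    rw [key] at h
    have hc : (2 * (n : ℝ) - 1) * ((i + 1 : ℕ) + 1) * (n - (i + 1 : ℕ)) /
        (n * (2 * n - 2 * (i + 1 : ℕ) - 1)) ≠ 0 := by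
      obtain ⟨d, rfl⟩ := Nat.exists_eq_add_of_lt hlt
      have h1 : (2 * ((i + 2 + d + 1 : ℕ) : ℝ) - 2 * (i + 1 : ℕ) - 1) = 2 * d + 3 := by
        push_cast; ring
      have h2 : 2 * ((i + 2 + d + 1 : ℕ) : ℝ) - 1 = 2 * i + 2 * d + 5 := by
        push_cast; ring
      have h3 : ((i + 2 + d + 1 : ℕ) : ℝ) - (i + 1 : ℕ) = d + 2 := by
        push_cast; ring
      rw [h1, h2, h3]
      positivity
    exact (mul_left_cancel₀ hc (add_right_cancel h)).symm

lemma ascPochhammer_eval_add_half (r h : ℕ) :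
    (ascPochhammer ℝ h).eval ((r : ℝ) + 1 / 2) * (4 ^ h * (r + h).factorial * (2 * r).factorial) =
      (2 * r + 2 * h).factorial * r.factorial := by
  induction h with
  | zero => simp; ring
  | succ h ih =>
    rw [ascPochhammer_succ_eval, ← add_assoc, show 2 * r + 2 * (h + 1) = 2 * r + 2 * h + 1 + 1 by ring]
    simp only [Nat.factorial_succ (r + h), Nat.factorial_succ (2 * r + 2 * h + 1),
      Nat.factorial_succ (2 * r + 2 * h)]
    push_cast
    linear_combination (2 * (r : ℝ) + 2 * h + 1) * (2 * r + 2 * h + 2) * ih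

lemma descPochhammer_eval_sub_half (r s : ℕ) :
    (descPochhammer ℝ s).eval (((r + s : ℕ) : ℝ) - 1 / 2) *
        (4 ^ s * (r + s).factorial * (2 * r).factorial) =
      (2 * (r + s)).factorial * r.factorial := by
  rw [descPochhammer_eval_eq_ascPochhammer,
    show ((r + s : ℕ) : ℝ) - 1 / 2 - s + 1 = r + 1 / 2 by push_cast; ring,
    ascPochhammer_eval_add_half, mul_add]

lemma pcoef_cast (r s i : ℕ) :
    (pcoef r s i : ℝ) = (s.choose i : ℝ) / 2 ^ i *
      ((descPochhammer ℝ (i / 2)).eval ((r : ℝ) + i - 1) *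
        (ascPochhammer ℝ i).eval ((r : ℝ) + 1)) /
      (ascPochhammer ℝ (i / 2)).eval ((r : ℝ) + 1 / 2) := by
  have hd (k : ℕ) (q : ℚ) : (((descPochhammer ℚ k).eval q : ℚ) : ℝ) =
      (descPochhammer ℝ k).eval (q : ℝ) := by
    rw [← descPochhammer_map (Rat.castHom ℝ), eval_map, ← Rat.coe_castHom, eval₂_hom]
  have ha (k : ℕ) (q : ℚ) : (((ascPochhammer ℚ k).eval q : ℚ) : ℝ) =
      (ascPochhammer ℝ k).eval (q : ℝ) := by
    rw [← ascPochhammer_map (Rat.castHom ℝ), eval_map, ← Rat.coe_castHom, eval₂_hom]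
  simp only [pcoef, Rat.cast_div, Rat.cast_mul, hd, ha]
  push_cast
  rfl

lemma factorial_floor_half_identity {r : ℕ} (hr : 0 < r) (i : ℕ) :
    2 ^ i * ((2 * r + 2 * (i / 2)).factorial * (r + i - 1 - i / 2).factorial) =
      4 ^ (i / 2) * (2 * ((r + i / 2).factorial * (2 * r + i - 1).factorial)) := by
  obtain ⟨t, rfl⟩ := Nat.exists_eq_add_of_le hr
  obtain ⟨h, rfl | rfl⟩ := i.even_or_odd'
  · rw [show 2 * h / 2 = h by omega, show 2 * (0 + 1 + t) + 2 * h = 2 * t + 2 * h + 1 + 1 by omega,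
      show 0 + 1 + t + 2 * h - 1 - h = t + h by omega, show 0 + 1 + t + h = t + h + 1 by omega,
      Nat.add_sub_cancel, Nat.factorial_succ (2 * t + 2 * h + 1), Nat.factorial_succ (t + h),
      pow_mul]
    ring
  · rw [show (2 * h + 1) / 2 = h by omega,
      show 2 * (0 + 1 + t) + (2 * h + 1) - 1 = 2 * (0 + 1 + t) + 2 * h by omega,
      show 0 + 1 + t + (2 * h + 1) - 1 - h = 0 + 1 + t + h by omega, pow_succ, pow_mul]
    ring

lemma pcoef_cast_mul_eq {r : ℕ} (hr : 0 < r) (s i : ℕ) (hi : i ≤ s) :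
    (pcoef r s i : ℝ) * (2 * (s - i).factorial * i.factorial * (2 * r + i - 1).factorial *
        r.factorial ^ 2) =
      s.factorial * (r + i - 1).factorial * (r + i).factorial * (2 * r).factorial := by
  have hdesc : (descPochhammer ℝ (i / 2)).eval ((r : ℝ) + i - 1) =
      (r + i - 1).factorial / (r + i - 1 - i / 2).factorial := by
    rw [show (r : ℝ) + i - 1 = ((r + i - 1 : ℕ) : ℝ) by
      rw [Nat.cast_sub (by omega)]; push_cast; ring,
      descPochhammer_eval_eq_descFactorial, eq_div_iff (by positivity), mul_comm]
    exact_mod_cast Nat.factorial_mul_descFactorial (show i / 2 ≤ r + i - 1 by omega)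
  have hasc : (ascPochhammer ℝ i).eval ((r : ℝ) + 1) = (r + i).factorial / r.factorial := by
    rw [← Nat.cast_add_one, ascPochhammer_nat_eq_natCast_ascFactorial,
      eq_div_iff (by positivity), mul_comm]
    exact_mod_cast Nat.factorial_mul_ascFactorial r i
  have hhalf : (ascPochhammer ℝ (i / 2)).eval ((r : ℝ) + 1 / 2) =
      (2 * r + 2 * (i / 2)).factorial * r.factorial /
        (4 ^ (i / 2) * (r + i / 2).factorial * (2 * r).factorial) := by
    rw [eq_div_iff (by positivity)]
    exact ascPochhammer_eval_add_half r (i / 2)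
  have hfact : (2 ^ i * ((2 * r + 2 * (i / 2)).factorial * (r + i - 1 - i / 2).factorial) : ℝ) =
      4 ^ (i / 2) * (2 * ((r + i / 2).factorial * (2 * r + i - 1).factorial)) := by
    exact_mod_cast factorial_floor_half_identity hr i
  rw [pcoef_cast, hdesc, hasc, hhalf, Nat.cast_choose ℝ hi]
  field_simp
  linear_combination -hfact

lemma parityCoef_eq_pcoef {r : ℕ} (hr : 0 < r) (s i : ℕ) (hi : i ≤ s) :
    parityCoef (r + s) s (s - i) =
      2 ^ (2 * s) / (s.factorial : ℝ) *
          ((descPochhammer ℝ s).eval (((r + s : ℕ) : ℝ) - 1 / 2) /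
            (descPochhammer ℝ s).eval ((r + s : ℕ) : ℝ)) * ((-1) ^ (s - i) * pcoef r s i) := by
  have hdesc : (descPochhammer ℝ s).eval ((r + s : ℕ) : ℝ) =
      (r + s).factorial / r.factorial := by
    rw [descPochhammer_eval_eq_descFactorial, eq_div_iff (by positivity), mul_comm]
    have := Nat.factorial_mul_descFactorial (show s ≤ r + s by omega)
    rw [Nat.add_sub_cancel] at this
    exact_mod_cast this
  have hhalf : (descPochhammer ℝ s).eval (((r + s : ℕ) : ℝ) - 1 / 2) =
      (2 * (r + s)).factorial * r.factorial /
        (4 ^ s * (r + s).factorial * (2 * r).factorial) := by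
    rw [eq_div_iff (by positivity)]
    exact descPochhammer_eval_sub_half r s
  have hp := pcoef_cast_mul_eq hr s i hi
  rw [← eq_div_iff (by positivity)] at hp
  rw [hp, hdesc, hhalf, parityCoef, if_pos (Nat.sub_le s i), commonCoef,
    show s - (s - i) = i by omega, show r + s - (s - i) = r + i - 1 + 1 by omega,
    show 2 * (r + s) - 1 - s - (s - i) = 2 * r + i - 1 by omega,
    show ((r + s : ℕ) : ℝ) - (s - i : ℕ) = ((r + i - 1 + 1 : ℕ) : ℝ) by
      rw [show r + i - 1 + 1 = r + i by omega, Nat.cast_sub hi]; push_cast; ring,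
    show (r + i).factorial = (r + i - 1 + 1).factorial by congr 1; omega,
    Nat.factorial_succ (r + i - 1), pow_mul]
  push_cast
  field_simp
  norm_num

/-- With `n = r + s`, let `(v_i)_{0 ≤ i ≤ s}` be the dual orthogonal
polynomials of the Johnson scheme `J(2n, n)`, determined by `v_0 = 1`, `v_1 = x` and the
three-term recursion. Then with `Ψ_s = ∑_{0 ≤ i ≤ s, i ≡ s (mod 2)} v_i` and
`θ_z = (2n − 1)(1 − 2z/n)`, one has
`Ψ_s(θ_z) = (2^{2s}/s!) ⬝ ((n − 1/2)^{↓s} / n^{↓s}) ⬝ Φ_s(z)` for all real `z`. -/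
theorem stmt_9 (r s : ℕ) (hr : 0 < r) (hs : 0 < s)
    (v : ℕ → Polynomial ℝ) (hv0 : v 0 = 1) (hv1 : v 1 = Polynomial.X)
    (hrec : ∀ i, 1 ≤ i → i ≤ s - 1 →
      Polynomial.X * v i =
        Polynomial.C ((2 * ((r + s : ℕ) : ℝ) - 1) * ((i : ℝ) + 1) * (((r + s : ℕ) : ℝ) - i) /
            (((r + s : ℕ) : ℝ) * (2 * ((r + s : ℕ) : ℝ) - 2 * i - 1))) * v (i + 1) +
        Polynomial.C ((2 * ((r + s : ℕ) : ℝ) - 1) * (((r + s : ℕ) : ℝ) - i + 1) *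
              (2 * ((r + s : ℕ) : ℝ) - i + 2) /
            (((r + s : ℕ) : ℝ) * (2 * ((r + s : ℕ) : ℝ) - 2 * i + 3))) * v (i - 1)) :
    ∀ z : ℝ,
      (∑ i ∈ (Finset.range (s + 1)).filter (fun i => i % 2 = s % 2), v i).eval
          ((2 * ((r + s : ℕ) : ℝ) - 1) * (1 - 2 * z / ((r + s : ℕ) : ℝ))) =
        2 ^ (2 * s) / (s.factorial : ℝ) *
          ((descPochhammer ℝ s).eval (((r + s : ℕ) : ℝ) - 1 / 2) /
            (descPochhammer ℝ s).eval ((r + s : ℕ) : ℝ)) *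
          Polynomial.aeval z (Phi r s) := by
  intro z
  have hn : s < r + s := by omega
  have hsum : (∑ i ∈ (Finset.range (s + 1)).filter (fun i => i % 2 = s % 2), v i).eval
      ((2 * ((r + s : ℕ) : ℝ) - 1) * (1 - 2 * z / ((r + s : ℕ) : ℝ))) =
      ∑ k ∈ range (s + 1), parityCoef (r + s) s k * (descPochhammer ℝ k).eval z := by
    rw [eval_finsetSum, sum_congr rfl fun i hi => dual_eval_eq_sum hn v hv0 hv1 hrec z i
      (by have := mem_range.1 (mem_filter.1 hi).1; omega), sum_comm]
    simp only [← sum_mul, parityCoef_eq_sum hn]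
    refine (sum_subset (range_subset_range.2 (by omega)) fun k _ hk => ?_).symm
    rw [mem_range, not_lt] at hk
    simp [parityCoef, show ¬ k ≤ s by omega]
  rw [hsum, ← sum_range_reflect, Phi, map_sum, mul_sum]
  refine sum_congr rfl fun i hi => ?_
  rw [Nat.add_sub_cancel, parityCoef_eq_pcoef hr s i (by have := mem_range.1 hi; omega), map_mul,
    aeval_C, ← descPochhammer_map (algebraMap ℚ ℝ) (s - i), eval_map_algebraMap]
  simp [mul_assoc]
end

section
/- Let m ≤ n be natural numbers with n ≥ 1 and let p ≥ 3 be a prime. Then val_p( (2n−1)!! / ((2(n−m)−1)!! · 2^m · m!) ) ≤ ⌊log_p(2n−1)⌋. -/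
open Nat

lemma Nat.factorial_two_mul_eq (n : ℕ) : (2 * n)! = (2 * n - 1)‼ * (2 ^ n * n !) := by
  rw [← doubleFactorial_two_mul]
  cases n with
  | zero => rfl
  | succ k => rw [mul_comm (2 * (k + 1) - 1)‼]; exact factorial_eq_mul_doubleFactorial (2 * k + 1)

/-- Hermite's identity for doubling, with an odd denominator. -/
lemma Nat.two_mul_div_of_odd {q : ℕ} (hq : Odd q) (n : ℕ) :
    2 * n / q = (n + q / 2) / q + n / q := by
  obtain ⟨h, rfl⟩ := hq
  have hh : (2 * h + 1) / 2 = h := by omega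
  rw [hh]
  obtain ⟨a, r, hr, rfl⟩ : ∃ a r, r < 2 * h + 1 ∧ n = r + (2 * h + 1) * a :=
    ⟨n / (2 * h + 1), n % (2 * h + 1), Nat.mod_lt _ (by omega), (Nat.mod_add_div _ _).symm⟩
  have hpos : 0 < 2 * h + 1 := by omega
  rw [show 2 * (r + (2 * h + 1) * a) = 2 * r + (2 * h + 1) * (2 * a) by ring,
    add_right_comm, Nat.add_mul_div_left _ _ hpos, Nat.add_mul_div_left _ _ hpos,
    Nat.add_mul_div_left _ _ hpos, Nat.div_eq_of_lt hr]
  have key : 2 * r / (2 * h + 1) = (r + h) / (2 * h + 1) := by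
    rcases le_or_gt r h with hle | hlt
    · rw [Nat.div_eq_of_lt (by omega), Nat.div_eq_of_lt (by omega)]
    · rw [Nat.div_eq_of_lt_le (k := 1) (by omega) (by omega),
        Nat.div_eq_of_lt_le (k := 1) (by omega) (by omega)]
  omega

lemma Nat.add_div_le_add_div_add_one (a b : ℕ) {q : ℕ} (hq : 0 < q) :
    (a + b) / q ≤ a / q + b / q + 1 := by
  rw [Nat.add_div hq]
  split_ifs <;> omega

/-- Legendre's formula for the double factorial of an odd number, at an odd prime. -/
lemma padicValNat_doubleFactorial_two_mul_sub_one {p : ℕ} [hp : Fact p.Prime] (hp3 : 3 ≤ p)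
    {n b : ℕ} (hb : Nat.log p (2 * n) < b) :
    padicValNat p (2 * n - 1)‼ = ∑ i ∈ Finset.Ico 1 b, (n + p ^ i / 2) / p ^ i := by
  have hodd : Odd p := hp.out.odd_of_ne_two (by omega)
  have hbn : Nat.log p n < b := (Nat.log_mono_right (by omega)).trans_lt hb
  have hmul := congrArg (padicValNat p) (Nat.factorial_two_mul_eq n)
  rw [padicValNat.mul (doubleFactorial_pos _).ne' (by positivity),
    padicValNat.mul (by positivity) (by positivity), padicValNat.pow,
    padicValNat.eq_zero_of_not_dvd (Nat.not_dvd_of_pos_of_lt two_pos hp3),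
    padicValNat_factorial hb, padicValNat_factorial hbn,
    Finset.sum_congr rfl fun i _ => Nat.two_mul_div_of_odd (hodd.pow (n := i)) n,
    Finset.sum_add_distrib] at hmul
  omega

lemma Nat.log_two_mul_eq_of_odd {p n : ℕ} (hp : Odd p) (hp1 : 1 < p) (hn : 1 ≤ n) :
    Nat.log p (2 * n) = Nat.log p (2 * n - 1) := by
  refine le_antisymm (Nat.le_log_of_pow_le hp1 ?_) (Nat.log_mono_right (by omega))
  have hle := Nat.pow_log_le_self p (x := 2 * n) (by omega)
  obtain ⟨c, hc⟩ := hp.pow (n := Nat.log p (2 * n))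
  omega

/-- For natural numbers `m ≤ n` with `n ≥ 1` and a prime `p ≥ 3`, the
`p`-adic valuation of the half-integer binomial coefficient
`C(n − 1/2, m) = (2n−1)!! / ((2(n−m)−1)!! ⬝ 2^m ⬝ m!)` is at most `⌊log_p (2n − 1)⌋`. -/
theorem stmt_10 (n m : ℕ) (hmn : m ≤ n) (hn : 1 ≤ n) (p : ℕ) (hp : p.Prime) (hp3 : 3 ≤ p) :
    padicValRat p (((2 * n - 1)‼ : ℚ) / (((2 * (n - m) - 1)‼ : ℚ) * 2 ^ m * (m ! : ℚ))) ≤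
      (Nat.log p (2 * n - 1) : ℤ) := by
  have : Fact p.Prime := ⟨hp⟩
  obtain ⟨k, rfl⟩ := Nat.exists_eq_add_of_le' hmn
  rw [Nat.add_sub_cancel]
  have hodd : Odd p := hp.odd_of_ne_two (by omega)
  set b := Nat.log p (2 * (k + m)) + 1 with hb
  have hlog {x : ℕ} (hx : x ≤ 2 * (k + m)) : Nat.log p x < b :=
    Nat.lt_succ_of_le (Nat.log_mono_right hx)
  have hsum : padicValNat p (2 * (k + m) - 1)‼ ≤
      padicValNat p (2 * k - 1)‼ + padicValNat p m ! + Nat.log p (2 * (k + m) - 1) := by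
    rw [padicValNat_doubleFactorial_two_mul_sub_one hp3 (hlog le_rfl),
      padicValNat_doubleFactorial_two_mul_sub_one hp3 (hlog (x := 2 * k) (by omega)),
      padicValNat_factorial (hlog (x := m) (by omega)),
      ← Nat.log_two_mul_eq_of_odd hodd hp.one_lt hn, ← Finset.sum_add_distrib]
    calc ∑ i ∈ Finset.Ico 1 b, (k + m + p ^ i / 2) / p ^ i
        ≤ ∑ i ∈ Finset.Ico 1 b, ((k + p ^ i / 2) / p ^ i + m / p ^ i + 1) := by
          refine Finset.sum_le_sum fun i _ => ?_
          rw [add_right_comm]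
          exact Nat.add_div_le_add_div_add_one _ _ (Nat.pow_pos hp.pos)
      _ = _ := by simp [Finset.sum_add_distrib, hb]
  have hden : ((2 * k - 1)‼ : ℚ) * 2 ^ m * (m ! : ℚ) =
      (((2 * k - 1)‼ * 2 ^ m * m ! : ℕ) : ℚ) := by push_cast; ring
  have hk := doubleFactorial_pos (2 * k - 1)
  have hnum := doubleFactorial_pos (2 * (k + m) - 1)
  rw [hden, padicValRat.div (by positivity) (by positivity), padicValRat.of_nat,
    padicValRat.of_nat, padicValNat.mul (by positivity) (by positivity),
    padicValNat.mul (by positivity) (by positivity), padicValNat.pow,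
    padicValNat.eq_zero_of_not_dvd (Nat.not_dvd_of_pos_of_lt two_pos hp3)]
  omega
end

section
/- Let m ≤ n be natural numbers with n ≥ 1. Then val_2( (2n−1)!! / ((2(n−m)−1)!! · 2^m · m!) ) ≤ −2m + ⌊log_2(m+1)⌋. -/
open Nat

theorem odd_doubleFactorial_two_mul_sub_one (k : ℕ) : Odd (2 * k - 1)‼ := by
  induction k with
  | zero => simp
  | succ k ih =>
    rw [show 2 * (k + 1) - 1 = 2 * k + 1 by omega, doubleFactorial_add_one]
    exact (odd_two_mul_add_one k).mul ih

theorem padicValRat_two_doubleFactorial_two_mul_sub_one (k : ℕ) :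
    padicValRat 2 ((2 * k - 1)‼ : ℚ) = 0 := by
  rw [padicValRat.of_nat, padicValNat.eq_zero_of_not_dvd
    (odd_doubleFactorial_two_mul_sub_one k).not_two_dvd_nat, Nat.cast_zero]

theorem le_padicValNat_two_factorial_add_log (m : ℕ) :
    m ≤ padicValNat 2 m ! + Nat.log 2 (m + 1) := by
  induction m using Nat.strong_induction_on with
  | _ m ih =>
    obtain ⟨k, rfl | rfl⟩ := m.even_or_odd'
    · rcases k.eq_zero_or_pos with rfl | hk
      · simp
      · have h := ih k (by omega)
        have hlog : Nat.log 2 (k + 1) ≤ Nat.log 2 (2 * k + 1) := Nat.log_mono_right (by omega)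
        rw [padicValNat_factorial_mul]
        omega
    · have h := ih k (by omega)
      have hlog : Nat.log 2 (2 * k + 1 + 1) = Nat.log 2 (k + 1) + 1 := by
        rw [show 2 * k + 1 + 1 = (k + 1) * 2 by ring]
        exact Nat.log_mul_base one_lt_two k.succ_ne_zero
      rw [padicValNat_factorial_mul_add k one_lt_two, padicValNat_factorial_mul]
      omega

/-- For natural numbers `m ≤ n` with `n ≥ 1`, the `2`-adic valuation of the
half-integer binomial coefficient `C(n − 1/2, m) = (2n−1)!! / ((2(n−m)−1)!! ⬝ 2^m ⬝ m!)`
is at most `−2m + ⌊log_2 (m + 1)⌋`. -/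
theorem stmt_11 (n m : ℕ) (hmn : m ≤ n) (hn : 1 ≤ n) :
    padicValRat 2 (((2 * n - 1)‼ : ℚ) / (((2 * (n - m) - 1)‼ : ℚ) * 2 ^ m * (m ! : ℚ))) ≤
      -(2 * (m : ℤ)) + (Nat.log 2 (m + 1) : ℤ) := by
  have hdf (k : ℕ) : (k‼ : ℚ) ≠ 0 := Nat.cast_ne_zero.mpr (doubleFactorial_pos k).ne'
  have hfac : (m ! : ℚ) ≠ 0 := Nat.cast_ne_zero.mpr m.factorial_ne_zero
  have hpow : (2 ^ m : ℚ) ≠ 0 := by positivity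
  have hself : padicValRat 2 (2 : ℚ) = 1 := padicValRat.self one_lt_two
  have h := le_padicValNat_two_factorial_add_log m
  rw [padicValRat.div (hdf _) (mul_ne_zero (mul_ne_zero (hdf _) hpow) hfac),
    padicValRat.mul (mul_ne_zero (hdf _) hpow) hfac, padicValRat.mul (hdf _) hpow,
    padicValRat_two_doubleFactorial_two_mul_sub_one,
    padicValRat_two_doubleFactorial_two_mul_sub_one, padicValRat.pow, hself,
    padicValRat.of_nat]
  omega
end

section
/- Let p be an odd prime and n ≥ 1 a natural number. Then for every natural number N with p^N > 2n−1, the p-adic valuation of the double factorial (2n−1)!! equals Σ_{i=1}^{N} ⌈(1/2)·⌊(2n−1)/p^i⌋⌉. -/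
open Nat Finset

theorem ceil_natCast_div_two (a : ℕ) : ⌈((a : ℚ) / 2)⌉ = (a : ℤ) - (a / 2 : ℕ) := by
  obtain ⟨k, hk⟩ | ⟨k, hk⟩ := Nat.even_or_odd a
  · have h : a / 2 = k := by omega
    rw [Int.ceil_eq_iff, h]
    subst hk
    push_cast
    constructor <;> linarith
  · have h : a / 2 = k := by omega
    rw [Int.ceil_eq_iff, h]
    subst hk
    push_cast
    constructor <;> linarith

theorem padicValNat_factorial_eq_add_of_odd (p : ℕ) [hp : Fact p.Prime] (hodd : Odd p) (m : ℕ) :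
    padicValNat p (2 * m + 1)! = padicValNat p (2 * m + 1)‼ + padicValNat p m ! := by
  have h2 : padicValNat p 2 = 0 := by
    refine padicValNat.eq_zero_of_not_dvd fun h => ?_
    have := (Nat.prime_dvd_prime_iff_eq hp.out Nat.prime_two).1 h
    subst this
    exact absurd hodd (by decide)
  rw [factorial_eq_mul_doubleFactorial, doubleFactorial_two_mul,
    padicValNat.mul (doubleFactorial_pos _).ne'
      (mul_ne_zero (pow_ne_zero _ two_ne_zero) (factorial_ne_zero m)),
    padicValNat.mul (pow_ne_zero _ two_ne_zero) (factorial_ne_zero m),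
    padicValNat.pow, h2, mul_zero, zero_add]

/-- For an odd prime `p` and `n ≥ 1`, for every `N` with `p^N > 2n − 1`, the
`p`-adic valuation of the double factorial `(2n − 1)!!` equals
`∑_{i=1}^{N} ⌈(1/2) ⬝ ⌊(2n − 1)/p^i⌋⌉`. -/
theorem stmt_12 (p : ℕ) (hp : p.Prime) (hodd : Odd p) (n : ℕ) (hn : 1 ≤ n) :
    ∀ N : ℕ, 2 * n - 1 < p ^ N →
      (padicValNat p ((2 * n - 1)‼) : ℤ) =
        ∑ i ∈ Finset.Icc 1 N, ⌈((((2 * n - 1) / p ^ i : ℕ) : ℚ) / 2)⌉ := by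
  intro N hN
  have := Fact.mk hp
  obtain ⟨m, rfl⟩ := Nat.exists_eq_add_of_le' hn
  rw [show 2 * (m + 1) - 1 = 2 * m + 1 by omega] at *
  have hlog {k : ℕ} (hk : k < p ^ N) : Nat.log p k < N + 1 :=
    Nat.log_lt_of_lt_pow' (Nat.succ_ne_zero N)
      (hk.trans_le (Nat.pow_le_pow_right hp.pos (Nat.le_succ N)))
  have h := padicValNat_factorial_eq_add_of_odd p hodd m
  rw [padicValNat_factorial (hlog hN),
    padicValNat_factorial (hlog (show m < p ^ N by omega))] at h
  have hIcc : Finset.Icc 1 N = Finset.Ico 1 (N + 1) := by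
    ext i
    simp only [Finset.mem_Icc, Finset.mem_Ico]
    omega
  have hdiv (i : ℕ) : (2 * m + 1) / p ^ i / 2 = m / p ^ i := by
    rw [Nat.div_div_eq_div_mul, mul_comm (p ^ i), ← Nat.div_div_eq_div_mul,
      show (2 * m + 1) / 2 = m by omega]
  simp only [ceil_natCast_div_two, hdiv, hIcc, Finset.sum_sub_distrib]
  zify at h
  push_cast at h ⊢
  linarith
end
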